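/- arXiv:2303.10660 — 8 statements merged into one kernel-verified Lean document; each statement's English description precedes it below -/
import Mathlib

section
/- For any p ≥ 0, the maximal CIS C_{max,p,co} of the system 𝒟(Σ_p) in the safe set S_{xu,p} × D equals the p-step backward reachable set Pre^p_{𝒟(Σ_p)}(C_{max,co} × D^p, S_{xu,p} × D) of the set C_{max,co} × D^p, where C_{max,co} is the maximal CIS of 𝒟(Σ) in S_{xu} × D. Furthermore, C_{max,p,co} ⊆ C_{max,co} × D^p. -/
open Set Pointwise

section Defs

variable {X U W : Type*}

/-- Robust controlled invariant set of `x⁺ = f x u d` (disturbance `d ∈ D`) in safe set `S`. -/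
def IsRCIS (f : X → U → W → X) (D : Set W) (S : Set (X × U)) (C : Set X) : Prop :=
  ∀ x ∈ C, ∃ u, (x, u) ∈ S ∧ ∀ d ∈ D, f x u d ∈ C

/-- Maximal RCIS: an RCIS containing every RCIS. -/
def IsMaxRCIS (f : X → U → W → X) (D : Set W) (S : Set (X × U)) (C : Set X) : Prop :=
  IsRCIS f D S C ∧ ∀ C', IsRCIS f D S C' → C' ⊆ C

/-- Controlled invariant set of the disturbance-free system `x⁺ = g x u` in safe set `S`. -/
def IsCIS (g : X → U → X) (S : Set (X × U)) (C : Set X) : Prop :=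
  ∀ x ∈ C, ∃ u, (x, u) ∈ S ∧ g x u ∈ C

/-- Maximal CIS. -/
def IsMaxCIS (g : X → U → X) (S : Set (X × U)) (C : Set X) : Prop :=
  IsCIS g S C ∧ ∀ C', IsCIS g S C' → C' ⊆ C

/-- One-step backward reachable set for a disturbance-free system. -/
def pre (g : X → U → X) (S : Set (X × U)) (T : Set X) : Set X :=
  {x | ∃ u, (x, u) ∈ S ∧ g x u ∈ T}

/-- `k`-step backward reachable set for a disturbance-free system. -/
def preN (g : X → U → X) (S : Set (X × U)) : ℕ → Set X → Set X
  | 0, T => T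
  | k + 1, T => pre g S (preN g S k T)

/-- One-step robust backward reachable set for a system with disturbance `d ∈ D`. -/
def preR (f : X → U → W → X) (D : Set W) (S : Set (X × U)) (T : Set X) : Set X :=
  {x | ∃ u, (x, u) ∈ S ∧ ∀ d ∈ D, f x u d ∈ T}

/-- `k`-step robust backward reachable set. -/
def preRN (f : X → U → W → X) (D : Set W) (S : Set (X × U)) : ℕ → Set X → Set X
  | 0, T => T
  | k + 1, T => preR f D S (preRN f D S k T)

/-- Dynamics of the `p`-augmented system `Σ_p`: state `(x, d_{1:p})`,
`x⁺ = f x u d₁`, `dᵢ⁺ = d_{i+1}`, `d_p⁺ = d` (new disturbance). -/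
def augDyn (f : X → U → W → X) (p : ℕ) :
    X × (Fin p → W) → U → W → X × (Fin p → W) :=
  fun s u dnew =>
    (f s.1 u (if h : 0 < p then s.2 ⟨0, h⟩ else dnew),
     fun i => if h : (i : ℕ) + 1 < p then s.2 ⟨(i : ℕ) + 1, h⟩ else dnew)

/-- Safe set `S_{xu,p}` of the `p`-augmented system. -/
def augSafe (S : Set (X × U)) (D : Set W) (p : ℕ) :
    Set ((X × (Fin p → W)) × U) :=
  {s | (s.1.1, s.2) ∈ S ∧ ∀ i, s.1.2 i ∈ D}

/-- Dynamics of the disturbance collaborative system `𝒟(Σ)`: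
the disturbance becomes a second control input. -/
def dcDyn (f : X → U → W → X) : X → U × W → X := fun x v => f x v.1 v.2

/-- Safe set `S_xu × D` of the disturbance collaborative system. -/
def dcSafe (S : Set (X × U)) (D : Set W) : Set (X × (U × W)) :=
  {s | (s.1, s.2.1) ∈ S ∧ s.2.2 ∈ D}

/-- The set `C × D^{p-p'}` viewed inside the state space of `Σ_p`, for `p' ≤ p`. -/
def liftSet {p' p : ℕ} (h : p' ≤ p) (C : Set (X × (Fin p' → W))) (D : Set W) :
    Set (X × (Fin p → W)) :=
  {s | (s.1, fun i : Fin p' => s.2 (Fin.castLE h i)) ∈ C ∧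
    ∀ i : Fin p, p' ≤ (i : ℕ) → s.2 i ∈ D}

/-- The set `C × D^p` viewed inside the state space of `Σ_p`, for `C ⊆ X`. -/
def prodD (C : Set X) (D : Set W) (p : ℕ) : Set (X × (Fin p → W)) :=
  {s | s.1 ∈ C ∧ ∀ i : Fin p, s.2 i ∈ D}

/-- The feasible domain `ℱ_p(C)` of the preview MPC with prediction horizon `p`
and terminal constraint set `C`. -/
def feasDom (f : X → U → W → X) (D : Set W) (S : Set (X × U)) (C : Set X) (p : ℕ) :
    Set (X × (Fin p → W)) :=
  {s | (∀ i, s.2 i ∈ D) ∧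
    ∃ xs : Fin (p + 1) → X, ∃ us : Fin p → U,
      xs 0 = s.1 ∧
      (∀ t : Fin p, xs t.succ = f (xs t.castSucc) (us t) (s.2 t) ∧
        (xs t.castSucc, us t) ∈ S) ∧
      xs (Fin.last p) ∈ C}

end Defs

/-- Linear dynamics `x⁺ = A x + B u + E d` on plain vector spaces `Fin n → ℝ`. -/
def linDyn {n m l : ℕ} (A : Matrix (Fin n) (Fin n) ℝ) (B : Matrix (Fin n) (Fin m) ℝ)
    (E : Matrix (Fin n) (Fin l) ℝ) :
    (Fin n → ℝ) → (Fin m → ℝ) → (Fin l → ℝ) → (Fin n → ℝ) :=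
  fun x u d => A.mulVec x + B.mulVec u + E.mulVec d

/-- Linear dynamics `x⁺ = A x + B u + E d` on Euclidean spaces. -/
noncomputable def linDynE {n m l : ℕ} (A : Matrix (Fin n) (Fin n) ℝ)
    (B : Matrix (Fin n) (Fin m) ℝ) (E : Matrix (Fin n) (Fin l) ℝ) :
    EuclideanSpace ℝ (Fin n) → EuclideanSpace ℝ (Fin m) → EuclideanSpace ℝ (Fin l) →
      EuclideanSpace ℝ (Fin n) :=
  fun x u d => (EuclideanSpace.equiv (Fin n) ℝ).symm
    (A.mulVec (EuclideanSpace.equiv (Fin n) ℝ x) + B.mulVec (EuclideanSpace.equiv (Fin m) ℝ u)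
      + E.mulVec (EuclideanSpace.equiv (Fin l) ℝ d))

section Trajectories

variable {X U W : Type*}

/-- A disturbance sequence `δ` in `D` is admissible from `x` when some input sequence keeps the
trajectory of `x⁺ = f x u d` driven by `δ` in the safe set `S` forever. -/
def IsAdmissible (f : X → U → W → X) (D : Set W) (S : Set (X × U)) (x : X) (δ : ℕ → W) : Prop :=
  (∀ t, δ t ∈ D) ∧ ∃ (xs : ℕ → X) (us : ℕ → U), xs 0 = x ∧
    ∀ t, xs (t + 1) = f (xs t) (us t) (δ t) ∧ (xs t, us t) ∈ S

variable {f : X → U → W → X} {D : Set W} {S : Set (X × U)}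

theorem IsAdmissible.cons {x : X} {u : U} {d : W} {δ : ℕ → W} (hS : (x, u) ∈ S) (hd : d ∈ D)
    (h : IsAdmissible f D S (f x u d) δ) :
    IsAdmissible f D S x (fun t => Nat.casesOn t d δ) := by
  obtain ⟨hδ, xs, us, h0, hstep⟩ := h
  refine ⟨fun t => ?_, fun t => Nat.casesOn t x xs, fun t => Nat.casesOn t u us, rfl, fun t => ?_⟩
  · cases t
    exacts [hd, hδ _]
  · cases t
    exacts [⟨h0, hS⟩, hstep _]

theorem IsAdmissible.exists_tail {x : X} {δ : ℕ → W} (h : IsAdmissible f D S x δ) :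
    ∃ u, (x, u) ∈ S ∧ IsAdmissible f D S (f x u (δ 0)) (fun t => δ (t + 1)) := by
  obtain ⟨hδ, xs, us, rfl, hstep⟩ := h
  exact ⟨us 0, (hstep 0).2, fun t => hδ _, fun t => xs (t + 1), fun t => us (t + 1),
    (hstep 0).1, fun t => hstep _⟩

theorem IsCIS.exists_isAdmissible {C : Set X} (hC : IsCIS (dcDyn f) (dcSafe S D) C) {x : X}
    (hx : x ∈ C) : ∃ δ, IsAdmissible f D S x δ := by
  choose v hv hnext using hC
  let y : ℕ → C := fun t => Nat.rec ⟨x, hx⟩ (fun _ z => ⟨dcDyn f z (v z z.2), hnext z z.2⟩) t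
  exact ⟨fun t => (v (y t).1 (y t).2).2, fun t => (hv _ (y t).2).2, fun t => (y t).1,
    fun t => (v (y t).1 (y t).2).1, rfl, fun t => ⟨rfl, (hv _ (y t).2).1⟩⟩

theorem pre_mono (g : X → U → X) (S : Set (X × U)) {T T' : Set X} (h : T ⊆ T') :
    pre g S T ⊆ pre g S T' :=
  fun _ ⟨u, hS, hT⟩ => ⟨u, hS, h hT⟩

theorem IsCIS.subset_preN {g : X → U → X} {C T : Set X} (hC : IsCIS g S C) (hT : C ⊆ T) (k : ℕ) :
    C ⊆ preN g S k T := by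
  induction k with
  | zero => exact hT
  | succ k ih => exact fun x hx => pre_mono g S ih (hC x hx)

/-- Projecting a controlled invariant set of `𝒟(Σ_p)` to the original state space yields a
controlled invariant set of `𝒟(Σ)`. -/
theorem IsCIS.image_fst {p : ℕ} {C : Set (X × (Fin p → W))}
    (hC : IsCIS (dcDyn (augDyn f p)) (dcSafe (augSafe S D p) D) C) :
    IsCIS (dcDyn f) (dcSafe S D) (Prod.fst '' C) := by
  rintro _ ⟨s, hs, rfl⟩
  obtain ⟨⟨u, d⟩, ⟨⟨hS, hD⟩, hd⟩, hnext⟩ := hC s hs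
  refine ⟨(u, if h : 0 < p then s.2 ⟨0, h⟩ else d), ⟨hS, ?_⟩, _, hnext, rfl⟩
  dsimp only
  split_ifs
  exacts [hD _, hd]

theorem isCIS_setOf_isAdmissible (f : X → U → W → X) (D : Set W) (S : Set (X × U)) (p : ℕ) :
    IsCIS (dcDyn (augDyn f p)) (dcSafe (augSafe S D p) D)
      {s | ∃ δ, IsAdmissible f D S s.1 δ ∧ ∀ i : Fin p, s.2 i = δ i} := by
  rintro s ⟨δ, hδ, hs⟩
  obtain ⟨u, hS, htail⟩ := hδ.exists_tail
  refine ⟨(u, δ p), ⟨⟨hS, fun i => hs i ▸ hδ.1 i⟩, hδ.1 p⟩, fun t => δ (t + 1), ?_, fun i => ?_⟩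
  · have h0 : (if h : 0 < p then s.2 ⟨0, h⟩ else δ p) = δ 0 := by
      split_ifs with h
      · exact hs _
      · rw [Nat.eq_zero_of_not_pos h]
    simpa only [dcDyn, augDyn, h0] using htail
  · simp only [dcDyn, augDyn]
    split_ifs with h
    · exact hs _
    · exact congrArg δ (by omega)

theorem exists_isAdmissible_of_mem_preN {p : ℕ} {C : Set X}
    (hC : IsCIS (dcDyn f) (dcSafe S D) C) {k : ℕ} (hk : k ≤ p) {s : X × (Fin p → W)}
    (hs : s ∈ preN (dcDyn (augDyn f p)) (dcSafe (augSafe S D p) D) k (prodD C D p)) :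
    ∃ δ, IsAdmissible f D S s.1 δ ∧ ∀ i : Fin p, (i : ℕ) < k → s.2 i = δ i := by
  induction k generalizing s with
  | zero =>
    obtain ⟨δ, hδ⟩ := hC.exists_isAdmissible hs.1
    exact ⟨δ, hδ, fun i hi => absurd hi (Nat.not_lt_zero _)⟩
  | succ k ih =>
    obtain ⟨⟨u, d⟩, ⟨⟨hS, hD⟩, -⟩, hnext⟩ := hs
    obtain ⟨δ, hδ, hagree⟩ := ih (by omega) hnext
    have hp : 0 < p := by omega
    simp only [dcDyn, augDyn, dif_pos hp] at hδ hagree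
    refine ⟨_, hδ.cons hS (hD _), ?_⟩
    rintro ⟨_ | i, hip⟩ hi
    · rfl
    · simpa only [dif_pos hip] using hagree ⟨i, by omega⟩ (by simpa using hi)

end Trajectories

/-- **Theorem 2 (maximal CIS of the delayed disturbance-collaborative system).**
For any `p ≥ 0`, the maximal CIS `C_{max,p,co}` of `𝒟(Σ_p)` in `S_{xu,p} × D` equals
the `p`-step backward reachable set of `C_{max,co} × D^p`, and
`C_{max,p,co} ⊆ C_{max,co} × D^p`. -/
theorem maxCIS_delayed_eq_preN {n m l : ℕ}
    (f : (Fin n → ℝ) → (Fin m → ℝ) → (Fin l → ℝ) → (Fin n → ℝ))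
    (D : Set (Fin l → ℝ)) (hDcpt : IsCompact D)
    (S : Set ((Fin n → ℝ) × (Fin m → ℝ)))
    (p : ℕ)
    (Cpco : Set ((Fin n → ℝ) × (Fin p → (Fin l → ℝ))))
    (Cco : Set (Fin n → ℝ))
    (hCpco : IsMaxCIS (dcDyn (augDyn f p)) (dcSafe (augSafe S D p) D) Cpco)
    (hCco : IsMaxCIS (dcDyn f) (dcSafe S D) Cco) :
    Cpco = preN (dcDyn (augDyn f p)) (dcSafe (augSafe S D p) D) p (prodD Cco D p) ∧
      Cpco ⊆ prodD Cco D p := by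
  have hsub : Cpco ⊆ prodD Cco D p := fun s hs => by
    obtain ⟨_, ⟨⟨-, hD⟩, -⟩, -⟩ := hCpco.1 s hs
    exact ⟨hCco.2 _ hCpco.1.image_fst ⟨s, hs, rfl⟩, hD⟩
  refine ⟨(hCpco.1.subset_preN hsub p).antisymm fun s hs => ?_, hsub⟩
  obtain ⟨δ, hδ, hagree⟩ := exists_isAdmissible_of_mem_preN hCco.1 le_rfl hs
  exact hCpco.2 _ (isCIS_setOf_isAdmissible f D S p) ⟨δ, hδ, fun i => hagree i i.2⟩
end

section
/- Suppose the disturbance collaborative system 𝒟(Σ) of the linear system Σ is stabilizable (there exist feedback gains K₁∈ℝ^{m×n}, K₂∈ℝ^{l×n} such that every eigenvalue of A+BK₁+EK₂ has modulus less than 1), the safe set S_xu and disturbance set D are convex and compact, and the origin is a forced equilibrium lying in the interior of S_xu × D with 0 ∈ π_n(C_{max,p_0}) for some p_0 ≥ 0. Then there exist γ ∈ (0,1], a positive integer N, and λ ∈ [0,1) such that γ C_{max,co} is an N-step λ-contractive CIS of 𝒟(Σ) in S_xu × D, i.e., γ C_{max,co} ⊆ Pre^N_{𝒟(Σ)}(λγ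 C_{max,co}, S_xu × D). -/
open Set Pointwise

/-- Powers of an element of a complex Banach algebra with spectrum in the open unit disc
tend to zero. -/
lemma tendsto_pow_zero_of_spectrum_lt_one {R : Type*} [NormedRing R] [NormedAlgebra ℂ R]
    [CompleteSpace R] (a : R) (h : ∀ μ ∈ spectrum ℂ a, ‖μ‖ < 1) :
    Filter.Tendsto (fun k : ℕ => a ^ k) Filter.atTop (nhds 0) := by
  have hrad : spectralRadius ℂ a < 1 := by
    rcases (spectrum ℂ a).eq_empty_or_nonempty with he | hne
    · simp [spectralRadius, he]
    · obtain ⟨μ, hμ, hr⟩ := spectrum.exists_nnnorm_eq_spectralRadius_of_nonempty hne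
      rw [← hr]
      exact_mod_cast h μ hμ
  obtain ⟨r, hr, hr1⟩ := ENNReal.lt_iff_exists_nnreal_btwn.1 hrad
  have hr1' : r < 1 := by exact_mod_cast hr1
  have hev := (spectrum.pow_nnnorm_pow_one_div_tendsto_nhds_spectralRadius a).eventually_lt_const hr
  refine squeeze_zero_norm' (a := fun k : ℕ => (r : ℝ) ^ k) ?_
    (tendsto_pow_atTop_nhds_zero_of_lt_one r.2 (by exact_mod_cast hr1'))
  filter_upwards [hev, Filter.eventually_gt_atTop 0] with k hk hk0
  have hk' : (0 : ℝ) < k := by exact_mod_cast hk0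
  have h2 := ENNReal.rpow_le_rpow hk.le hk'.le
  rw [← ENNReal.rpow_mul, one_div_mul_cancel hk'.ne', ENNReal.rpow_one, ENNReal.rpow_natCast] at h2
  exact_mod_cast h2

open scoped Matrix.Norms.Operator in
/-- Schur stability of a real matrix: if all complex eigenvalues lie in the open unit disc,
then the powers tend to zero in norm. -/
lemma Matrix.tendsto_norm_pow_zero_of_spectrum_lt_one {n : ℕ} (M : Matrix (Fin n) (Fin n) ℝ)
    (h : ∀ μ ∈ spectrum ℂ (M.map Complex.ofReal), ‖μ‖ < 1) :
    Filter.Tendsto (fun k : ℕ => ‖M ^ k‖) Filter.atTop (nhds 0) := by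
  have hC := tendsto_pow_zero_of_spectrum_lt_one (M.map Complex.ofReal) h
  rw [← tendsto_zero_iff_norm_tendsto_zero]
  have hcont : Continuous (fun P : Matrix (Fin n) (Fin n) ℂ => P.map Complex.re) :=
    continuous_id.matrix_map Complex.continuous_re
  have hre := (hcont.tendsto 0).comp hC
  have h0 : (0 : Matrix (Fin n) (Fin n) ℂ).map Complex.re = 0 := by ext; simp
  rw [h0] at hre
  refine hre.congr fun k => ?_
  have hp : (M.map Complex.ofReal) ^ k = (M ^ k).map Complex.ofReal :=
    (map_pow Complex.ofRealHom.mapMatrix M k).symm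
  ext i j
  simp [hp]

/-- If the trajectory from `x` under the linear feedback `(K₁, K₂)` remains safe for `N` steps,
then `x` lies in the `N`-step backward reachable set of any set containing its endpoint. -/
lemma mem_preN_of_feedback {n m l : ℕ} (A : Matrix (Fin n) (Fin n) ℝ)
    (B : Matrix (Fin n) (Fin m) ℝ) (E : Matrix (Fin n) (Fin l) ℝ)
    (K₁ : Matrix (Fin m) (Fin n) ℝ) (K₂ : Matrix (Fin l) (Fin n) ℝ)
    (T : Set ((Fin n → ℝ) × ((Fin m → ℝ) × (Fin l → ℝ)))) (Y : Set (Fin n → ℝ)) (N : ℕ) :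
    ∀ x : Fin n → ℝ,
      (∀ k < N, (((A + B * K₁ + E * K₂) ^ k).mulVec x,
        (K₁.mulVec (((A + B * K₁ + E * K₂) ^ k).mulVec x),
          K₂.mulVec (((A + B * K₁ + E * K₂) ^ k).mulVec x))) ∈ T) →
      ((A + B * K₁ + E * K₂) ^ N).mulVec x ∈ Y →
      x ∈ preN (dcDyn (linDyn A B E)) T N Y := by
  induction N with
  | zero => intro x _ hY; simpa [preN] using hY
  | succ N ih =>
    intro x hT hY
    have hstep : dcDyn (linDyn A B E) x (K₁.mulVec x, K₂.mulVec x) =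
        (A + B * K₁ + E * K₂).mulVec x := by
      simp [dcDyn, linDyn, Matrix.add_mulVec, Matrix.mulVec_mulVec]
    refine ⟨(K₁.mulVec x, K₂.mulVec x), by simpa using hT 0 N.succ_pos, ?_⟩
    rw [hstep]
    refine ih _ (fun k hk => ?_) ?_
    · simpa only [Matrix.mulVec_mulVec, ← pow_succ] using hT (k + 1) (by omega)
    · simpa only [Matrix.mulVec_mulVec, ← pow_succ] using hY

open scoped Matrix.Norms.Operator in
/-- **Lemma (existence of an `N`-step `λ`-contractive scaled maximal CIS).**
If `𝒟(Σ)` is stabilizable, `S_xu` and `D` are convex compact, and the origin is a forced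
equilibrium in the interior of `S_xu × D` with `0 ∈ π_n(C_{max,p₀})`, then there exist
`γ ∈ (0,1]`, `N ≥ 1` and `λ ∈ [0,1)` such that `γ C_{max,co}` is an `N`-step
`λ`-contractive CIS of `𝒟(Σ)` in `S_xu × D`. -/
theorem exists_contractive_scaled_maxCIS {n m l : ℕ}
    (A : Matrix (Fin n) (Fin n) ℝ) (B : Matrix (Fin n) (Fin m) ℝ)
    (E : Matrix (Fin n) (Fin l) ℝ)
    (hstab : ∃ (K₁ : Matrix (Fin m) (Fin n) ℝ) (K₂ : Matrix (Fin l) (Fin n) ℝ),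
      ∀ μ ∈ spectrum ℂ ((A + B * K₁ + E * K₂).map (Complex.ofReal)), ‖μ‖ < 1)
    (D : Set (Fin l → ℝ)) (S : Set ((Fin n → ℝ) × (Fin m → ℝ)))
    (hDconv : Convex ℝ D) (hDcpt : IsCompact D)
    (hSconv : Convex ℝ S) (hScpt : IsCompact S)
    (h0int : ((0 : Fin n → ℝ), ((0 : Fin m → ℝ), (0 : Fin l → ℝ))) ∈
      interior (dcSafe S D))
    (p₀ : ℕ)
    (Cp₀ : Set ((Fin n → ℝ) × (Fin p₀ → (Fin l → ℝ))))
    (hCp₀ : IsMaxRCIS (augDyn (linDyn A B E) p₀) D (augSafe S D p₀) Cp₀)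
    (h0proj : (0 : Fin n → ℝ) ∈ Prod.fst '' Cp₀)
    (Cco : Set (Fin n → ℝ))
    (hCco : IsMaxCIS (dcDyn (linDyn A B E)) (dcSafe S D) Cco) :
    ∃ (γ : ℝ) (N : ℕ) (lam : ℝ), 0 < γ ∧ γ ≤ 1 ∧ 0 < N ∧ 0 ≤ lam ∧ lam < 1 ∧
      γ • Cco ⊆ preN (dcDyn (linDyn A B E)) (dcSafe S D) N ((lam * γ) • Cco) := by
  obtain ⟨K₁, K₂, hK⟩ := hstab
  set M := A + B * K₁ + E * K₂ with hM
  have hlim := Matrix.tendsto_norm_pow_zero_of_spectrum_lt_one M hK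
  let F : (Fin n → ℝ) → (Fin n → ℝ) × ((Fin m → ℝ) × (Fin l → ℝ)) :=
    fun x => (x, (K₁.mulVec x, K₂.mulVec x))
  have hF : Continuous F := by fun_prop
  obtain ⟨δ, hδ, hball⟩ : ∃ δ > 0, ∀ x : Fin n → ℝ, ‖x‖ < δ → F x ∈ dcSafe S D := by
    have hnhds : F ⁻¹' dcSafe S D ∈ nhds 0 :=
      hF.continuousAt.preimage_mem_nhds (by simpa [F] using mem_interior_iff_mem_nhds.1 h0int)
    obtain ⟨δ, hδ, h⟩ := Metric.mem_nhds_iff.1 hnhds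
    exact ⟨δ, hδ, fun x hx => h (by simpa using hx)⟩
  obtain ⟨c, hc⟩ := hlim.bddAbove_range
  have hc' : ∀ k, ‖M ^ k‖ ≤ max c 1 := fun k => (hc ⟨k, rfl⟩).trans (le_max_left _ _)
  have hcpos : 0 < max c 1 := lt_max_of_lt_right one_pos
  have hsafe : ∀ x : Fin n → ℝ, ‖x‖ < δ / max c 1 → ∀ k, F ((M ^ k).mulVec x) ∈ dcSafe S D := by
    intro x hx k
    refine hball _ ?_
    calc ‖(M ^ k).mulVec x‖ ≤ ‖M ^ k‖ * ‖x‖ := Matrix.linfty_opNorm_mulVec _ _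
      _ ≤ max c 1 * ‖x‖ := by gcongr; exact hc' k
      _ < δ := by rwa [lt_div_iff₀' hcpos] at hx
  set ε := δ / max c 1 with hε
  have hεpos : 0 < ε := by positivity
  have hCball : ∀ x : Fin n → ℝ, ‖x‖ < ε → x ∈ Cco := by
    intro x hx
    refine hCco.2 {x | ∀ k, F ((M ^ k).mulVec x) ∈ dcSafe S D} ?_ (hsafe x hx)
    intro y hy
    refine ⟨(K₁.mulVec y, K₂.mulVec y), by simpa [F] using hy 0, fun k => ?_⟩
    have hstep : dcDyn (linDyn A B E) y (K₁.mulVec y, K₂.mulVec y) = M.mulVec y := by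
      simp [hM, dcDyn, linDyn, Matrix.add_mulVec, Matrix.mulVec_mulVec]
    rw [hstep, Matrix.mulVec_mulVec, ← pow_succ]
    exact hy (k + 1)
  obtain ⟨r, hr⟩ := hScpt.isBounded.exists_norm_le
  have hCbdd : ∀ x ∈ Cco, ‖x‖ ≤ max r 1 := by
    intro x hx
    obtain ⟨u, hu, -⟩ := hCco.1 x hx
    exact ((norm_fst_le _).trans (hr _ hu.1)).trans (le_max_left _ _)
  set R := max r 1
  have hR : 0 < R := lt_max_of_lt_right one_pos
  obtain ⟨N, hN, hN0⟩ := ((hlim.eventually_lt_const (u := ε / (2 * R)) (by positivity)).and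
    (Filter.eventually_gt_atTop 0)).exists
  obtain ⟨γ, hγ, hγ1, hγε⟩ : ∃ γ : ℝ, 0 < γ ∧ γ ≤ 1 ∧ γ * R < ε := by
    refine ⟨min 1 (ε / (2 * R)), by positivity, min_le_left _ _, ?_⟩
    calc min 1 (ε / (2 * R)) * R ≤ ε / (2 * R) * R := by gcongr; exact min_le_right _ _
      _ = ε / 2 := by field_simp
      _ < ε := half_lt_self hεpos
  refine ⟨γ, N, 1 / 2, hγ, hγ1, hN0, by norm_num, by norm_num, ?_⟩
  rintro _ ⟨x, hx, rfl⟩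
  refine mem_preN_of_feedback A B E K₁ K₂ _ _ N (γ • x) (fun k _ => hsafe _ ?_ k) ?_
  · rw [norm_smul, Real.norm_of_nonneg hγ.le]
    exact lt_of_le_of_lt (by gcongr; exact hCbdd x hx) hγε
  · refine ⟨(2 : ℝ) • (M ^ N).mulVec x, hCball _ ?_, ?_⟩
    · rw [norm_smul, Real.norm_of_nonneg zero_le_two]
      calc 2 * ‖(M ^ N).mulVec x‖ ≤ 2 * (‖M ^ N‖ * ‖x‖) := by
            gcongr; exact Matrix.linfty_opNorm_mulVec _ _
        _ ≤ 2 * (‖M ^ N‖ * R) := by gcongr; exact hCbdd x hx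
        _ < 2 * (ε / (2 * R) * R) := by gcongr
        _ = ε := by field_simp
    · simp only [Matrix.mulVec_smul, smul_smul]
      congr 1
      ring
end

section
/- Suppose Σ is linear, S_xu and D are convex and compact, the origin is a forced equilibrium of 𝒟(Σ) in the interior of S_xu × D, and 𝒟(Σ) is controllable (the pair (A,[B E]) is controllable, i.e., the matrix [ [B E], A[B E], …, A^{n−1}[B E] ] has rank n). Then for any N ≥ n, there exists a scalar γ ∈ (0,1] such that γ C_{max,co} ⊆ Pre^N_{𝒟(Σ)}({0}, S_xu × D); i.e., γ C_{max,co} is an N-step 0-contractive CIS of 𝒟(Σ) in S_xu × D. -/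
open Set Pointwise

section LinearSystem

variable {X V : Type*} [AddCommGroup X] [Module ℝ X] [AddCommGroup V] [Module ℝ V]

/-- The states reachable from the origin of `x⁺ = F x + G v` in `N` steps. -/
def reachSubmodule (F : X →ₗ[ℝ] X) (G : V →ₗ[ℝ] X) (N : ℕ) : Submodule ℝ X :=
  Submodule.span ℝ {x | ∃ k : ℕ, k < N ∧ ∃ v : V, x = (F ^ k) (G v)}

theorem reachSubmodule_mono (F : X →ₗ[ℝ] X) (G : V →ₗ[ℝ] X) : Monotone (reachSubmodule F G) :=
  fun _ _ h => Submodule.span_mono fun _ ⟨k, hk, v, hv⟩ => ⟨k, hk.trans_le h, v, hv⟩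

theorem reachSubmodule_succ_le (F : X →ₗ[ℝ] X) (G : V →ₗ[ℝ] X) (N : ℕ) :
    reachSubmodule F G (N + 1) ≤ reachSubmodule F G N ⊔ LinearMap.range ((F ^ N) ∘ₗ G) := by
  refine Submodule.span_le.2 ?_
  rintro _ ⟨k, hk, v, rfl⟩
  rcases Nat.lt_succ_iff_lt_or_eq.1 hk with h | rfl
  · exact Submodule.mem_sup_left (Submodule.subset_span ⟨k, h, v, rfl⟩)
  · exact Submodule.mem_sup_right ⟨v, rfl⟩

/-- The states from which `x⁺ = F x + G v` can be steered to the origin in `N` steps. -/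
def nullCtrlSubmodule (F : X →ₗ[ℝ] X) (G : V →ₗ[ℝ] X) (N : ℕ) : Submodule ℝ X :=
  (reachSubmodule F G N).comap (F ^ N)

theorem nullCtrlSubmodule_zero (F : X →ₗ[ℝ] X) (G : V →ₗ[ℝ] X) :
    nullCtrlSubmodule F G 0 = ⊥ := by
  have : reachSubmodule F G 0 = ⊥ := by simp [reachSubmodule]
  simp [nullCtrlSubmodule, this, Module.End.one_eq_id]

theorem exists_mem_nullCtrlSubmodule (F : X →ₗ[ℝ] X) (G : V →ₗ[ℝ] X) {N : ℕ} {x : X}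
    (hx : x ∈ nullCtrlSubmodule F G (N + 1)) : ∃ v, F x + G v ∈ nullCtrlSubmodule F G N := by
  obtain ⟨r, hr, _, ⟨v, rfl⟩, h⟩ := Submodule.mem_sup.1 (reachSubmodule_succ_le F G N hx)
  refine ⟨-v, ?_⟩
  have : (F ^ N) (F x + G (-v)) = r := by
    rw [map_add, ← Module.End.mul_apply, ← pow_succ, ← h]
    simp
  rwa [nullCtrlSubmodule, Submodule.mem_comap, this]

/-- A control chosen pointwise to enter a subspace can be chosen linearly in the state. -/
theorem exists_linear_feedback (F : X →ₗ[ℝ] X) (G : V →ₗ[ℝ] X) (K K' : Submodule ℝ X)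
    (h : ∀ x ∈ K, ∃ v, F x + G v ∈ K') : ∃ σ : X →ₗ[ℝ] V, ∀ x ∈ K, F x + G (σ x) ∈ K' := by
  choose f hf using fun x : K => h x x.2
  let b := Module.Basis.ofVectorSpace ℝ K
  obtain ⟨σ, hσ⟩ := (b.constr ℝ fun i => f (b i)).exists_extend
  refine ⟨σ, fun x hx => ?_⟩
  have key : ⊤ ≤ (K'.comap (F + G ∘ₗ σ)).comap K.subtype := by
    rw [← b.span_eq, Submodule.span_le]
    rintro _ ⟨i, rfl⟩
    have : σ (b i) = f (b i) := by
      simpa using LinearMap.congr_fun hσ (b i)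
    simpa [this] using hf (b i)
  exact key (x := ⟨x, hx⟩) trivial

end LinearSystem

/-- Near the origin, every null-controllable state is steered to the origin inside a safe set that
is a neighbourhood of the origin. -/
theorem eventually_mem_preN {X V : Type*} [NormedAddCommGroup X] [NormedSpace ℝ X]
    [FiniteDimensional ℝ X] [NormedAddCommGroup V] [NormedSpace ℝ V]
    (F : X →ₗ[ℝ] X) (G : V →ₗ[ℝ] X) {T : Set (X × V)} (hT : T ∈ nhds 0) (N : ℕ) :
    ∀ᶠ x in nhds (0 : X), x ∈ nullCtrlSubmodule F G N →
      x ∈ preN (fun x v => F x + G v) T N {0} := by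
  induction N with
  | zero =>
    refine Filter.Eventually.of_forall fun x hx => ?_
    simpa [nullCtrlSubmodule_zero, preN] using hx
  | succ N ih =>
    obtain ⟨σ, hσ⟩ := exists_linear_feedback F G (nullCtrlSubmodule F G (N + 1))
      (nullCtrlSubmodule F G N) fun x hx => exists_mem_nullCtrlSubmodule F G hx
    have hstep : Filter.Tendsto (F + G ∘ₗ σ) (nhds 0) (nhds 0) := by
      simpa using (F + G ∘ₗ σ).continuous_of_finiteDimensional.tendsto 0
    have hsafe : Filter.Tendsto (fun x => (x, σ x)) (nhds 0) (nhds (0 : X × V)) := by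
      have := (continuous_id.prodMk σ.continuous_of_finiteDimensional).tendsto 0
      simpa only [id, map_zero, Prod.mk_zero_zero] using this
    filter_upwards [hstep.eventually ih, hsafe hT] with x hnext hmem hx
    exact ⟨σ x, hmem, hnext (hσ x hx)⟩

theorem exists_smul_subset_of_mem_nhds {X : Type*} [NormedAddCommGroup X] [NormedSpace ℝ X]
    {C T : Set X} (hC : Bornology.IsBounded C) (hT : T ∈ nhds 0) :
    ∃ γ : ℝ, 0 < γ ∧ γ ≤ 1 ∧ γ • C ⊆ T := by
  obtain ⟨r, hr, hrT⟩ := Metric.mem_nhds_iff.1 hT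
  obtain ⟨M, hM, hCM⟩ := hC.exists_pos_norm_lt
  refine ⟨min 1 (r / M), by positivity, min_le_left _ _, ?_⟩
  rintro _ ⟨x, hx, rfl⟩
  refine hrT (mem_ball_zero_iff.2 ?_)
  have hγ : 0 < min 1 (r / M) := by positivity
  calc ‖min 1 (r / M) • x‖ = min 1 (r / M) * ‖x‖ := by rw [norm_smul, Real.norm_of_nonneg hγ.le]
    _ < min 1 (r / M) * M := mul_lt_mul_of_pos_left (hCM x hx) hγ
    _ ≤ r / M * M := mul_le_mul_of_nonneg_right (min_le_right _ _) hM.le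
    _ = r := div_mul_cancel₀ r hM.ne'

/-- **Lemma (`N`-step `0`-contractiveness under controllability).**
If `𝒟(Σ)` is controllable, `S_xu` and `D` are convex compact, and the origin is a forced
equilibrium in the interior of `S_xu × D`, then for any `N ≥ n` there exists `γ ∈ (0,1]`
with `γ C_{max,co} ⊆ Pre^N_{𝒟(Σ)}({0}, S_xu × D)`. -/
theorem exists_zero_contractive_scaled_maxCIS {n m l : ℕ}
    (A : Matrix (Fin n) (Fin n) ℝ) (B : Matrix (Fin n) (Fin m) ℝ)
    (E : Matrix (Fin n) (Fin l) ℝ)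
    (hctrb : Submodule.span ℝ
      {v : Fin n → ℝ | ∃ k : ℕ, k < n ∧ ∃ (w : Fin m → ℝ) (z : Fin l → ℝ),
        v = (A ^ k).mulVec (B.mulVec w + E.mulVec z)} = ⊤)
    (D : Set (Fin l → ℝ)) (S : Set ((Fin n → ℝ) × (Fin m → ℝ)))
    (hDconv : Convex ℝ D) (hDcpt : IsCompact D)
    (hSconv : Convex ℝ S) (hScpt : IsCompact S)
    (h0int : ((0 : Fin n → ℝ), ((0 : Fin m → ℝ), (0 : Fin l → ℝ))) ∈
      interior (dcSafe S D))
    (Cco : Set (Fin n → ℝ))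
    (hCco : IsMaxCIS (dcDyn (linDyn A B E)) (dcSafe S D) Cco) :
    ∀ N : ℕ, n ≤ N → ∃ γ : ℝ, 0 < γ ∧ γ ≤ 1 ∧
      γ • Cco ⊆ preN (dcDyn (linDyn A B E)) (dcSafe S D) N {0} := by
  intro N hN
  set F := Matrix.toLin' A
  set G := (Matrix.toLin' B).coprod (Matrix.toLin' E)
  have hdyn : dcDyn (linDyn A B E) = fun x v => F x + G v := by
    funext x v
    simp [dcDyn, linDyn, F, G, add_assoc]
  have hreach : reachSubmodule F G n = ⊤ := by
    rw [← hctrb, reachSubmodule]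
    congr 1
    ext x
    simp [F, G, ← Matrix.toLin'_pow]
  have hnull : nullCtrlSubmodule F G N = ⊤ := by
    have : reachSubmodule F G N = ⊤ := top_le_iff.1 (hreach ▸ reachSubmodule_mono F G hN)
    rw [nullCtrlSubmodule, this, Submodule.comap_top]
  have hbdd : Bornology.IsBounded Cco := by
    refine (hScpt.image continuous_fst).isBounded.subset fun x hx => ?_
    obtain ⟨v, hv, -⟩ := hCco.1 x hx
    exact ⟨_, hv.1, rfl⟩
  refine exists_smul_subset_of_mem_nhds hbdd ?_
  rw [hdyn]
  filter_upwards [eventually_mem_preN F G (mem_interior_iff_mem_nhds.1 h0int) N] with x hx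
  exact hx (hnull ▸ Submodule.mem_top)
end

section
/- For a linear system Σ with p-step preview and an RCIS C of Σ in S_xu, the feasible domain ℱ_p(C) of the model predictive controller with prediction horizon p, constraints x_t = Ax_{t−1}+Bu_{t−1}+Ed_{t−1}, (x_{t−1},u_{t−1}) ∈ S_xu for t ∈ [p], and terminal constraint x_p ∈ C, equals the p-step backward reachable set of C × D^p for the p-augmented system Σ_p in S_{xu,p}: ℱ_p(C) = Pre^p_{Σ_p}(C × D^p, S_{xu,p}). -/
open Set Pointwise

theorem augDyn_snd_castLE {X U W : Type*} (f : X → U → W → X) {p k : ℕ} (h : k + 1 ≤ p)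
    (s : X × (Fin p → W)) (u : U) (d : W) (t : Fin k) :
    (augDyn f p s u d).2 (Fin.castLE (Nat.le_of_succ_le h) t) = s.2 (Fin.castLE h t.succ) := by
  have ht : (t : ℕ) + 1 < p := by omega
  simp only [augDyn, Fin.val_castLE, ht, dite_true]
  rfl

theorem augDyn_fst {X U W : Type*} (f : X → U → W → X) {p k : ℕ} (h : k + 1 ≤ p)
    (s : X × (Fin p → W)) (u : U) (d : W) :
    (augDyn f p s u d).1 = f s.1 u (s.2 (Fin.castLE h 0)) := by
  have hp : 0 < p := by omega
  simp only [augDyn, hp, dite_true]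
  rfl

theorem augDyn_snd_mem {X U W : Type*} (f : X → U → W → X) {D : Set W} {p : ℕ}
    {s : X × (Fin p → W)} (hs : ∀ i, s.2 i ∈ D) (u : U) {d : W} (hd : d ∈ D) (i : Fin p) :
    (augDyn f p s u d).2 i ∈ D := by
  simp only [augDyn]
  split_ifs
  · exact hs _
  · exact hd

/-- The `k`-step backward reachable set of `C × D^p` for `Σ_p`, with `k ≤ p`, consists of the
states whose previewed disturbances allow the state to be steered safely into `C` in `k` steps. -/
theorem mem_preRN_augDyn_iff {X U W : Type*} (f : X → U → W → X) (D : Set W)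
    (S : Set (X × U)) (C : Set X) {p : ℕ} (k : ℕ) (h : k ≤ p) (s : X × (Fin p → W)) :
    s ∈ preRN (augDyn f p) D (augSafe S D p) k (prodD C D p) ↔
      (∀ i, s.2 i ∈ D) ∧ ∃ xs : Fin (k + 1) → X, ∃ us : Fin k → U,
        xs 0 = s.1 ∧
        (∀ t : Fin k, xs t.succ = f (xs t.castSucc) (us t) (s.2 (Fin.castLE h t)) ∧
          (xs t.castSucc, us t) ∈ S) ∧
        xs (Fin.last k) ∈ C := by
  induction k generalizing s with
  | zero =>
    constructor
    · rintro ⟨hC, hD⟩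
      exact ⟨hD, fun _ => s.1, Fin.elim0, rfl, fun t => t.elim0, hC⟩
    · rintro ⟨hD, xs, us, h0, -, hC⟩
      exact ⟨h0 ▸ hC, hD⟩
  | succ k ih =>
    constructor
    · rintro ⟨u, ⟨hS, hD⟩, hstep⟩
      obtain ⟨-, xs, us, h0, ht, hC⟩ := (ih (by omega) _).1 (hstep _ (hD (Fin.castLE h 0)))
      refine ⟨hD, Fin.cons s.1 xs, Fin.cons u us, rfl, ?_, hC⟩
      intro t
      cases t using Fin.cases with
      | zero => exact ⟨h0.trans (augDyn_fst f h s u _), hS⟩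
      | succ t =>
        have htt := ht t
        rw [augDyn_snd_castLE f h] at htt
        exact htt
    · rintro ⟨hD, xs, us, h0, ht, hC⟩
      have hzero := ht 0
      rw [Fin.castSucc_zero, h0] at hzero
      refine ⟨us 0, ⟨hzero.2, hD⟩, fun d hd => (ih (by omega) _).2
        ⟨augDyn_snd_mem f hD _ hd, Fin.tail xs, Fin.tail us, ?_, ?_, hC⟩⟩
      · rw [augDyn_fst f h]
        exact hzero.1
      · intro t
        rw [augDyn_snd_castLE f h]
        exact ht t.succ

/-- **Theorem (MPC feasible domain as a backward reachable set).**
For a linear system with `p`-step preview and an RCIS `C` of `Σ` in `S_xu`, the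
feasible domain of the terminal-constraint MPC equals the `p`-step backward reachable
set of `C × D^p` for `Σ_p` in `S_{xu,p}`:
`ℱ_p(C) = Pre^p_{Σ_p}(C × D^p, S_{xu,p})`. -/
theorem feasDom_eq_preRN {n m l : ℕ}
    (A : Matrix (Fin n) (Fin n) ℝ) (B : Matrix (Fin n) (Fin m) ℝ)
    (E : Matrix (Fin n) (Fin l) ℝ)
    (D : Set (Fin l → ℝ)) (hDcpt : IsCompact D)
    (S : Set ((Fin n → ℝ) × (Fin m → ℝ)))
    (C : Set (Fin n → ℝ)) (hC : IsRCIS (linDyn A B E) D S C)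
    (p : ℕ) :
    feasDom (linDyn A B E) D S C p =
      preRN (augDyn (linDyn A B E) p) D (augSafe S D p) p (prodD C D p) := by
  ext s
  exact (mem_preRN_augDyn_iff _ D S C p le_rfl s).symm
end

section
/- For a linear system Σ and any set C ⊆ ℝ^n, the projection of the MPC feasible domain ℱ_p(C) onto the first n coordinates equals the p-step backward reachable set of C with respect to the disturbance collaborative system 𝒟(Σ) in S_xu × D: π_n(ℱ_p(C)) = Pre^p_{𝒟(Σ)}(C, S_xu × D). -/
open Set Pointwise

theorem mem_feasDom_succ {X U W : Type*} {f : X → U → W → X} {D : Set W} {S : Set (X × U)}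
    {C : Set X} {p : ℕ} {x : X} {d : Fin (p + 1) → W} :
    (x, d) ∈ feasDom f D S C (p + 1) ↔
      d 0 ∈ D ∧ ∃ u, (x, u) ∈ S ∧ (f x u (d 0), Fin.tail d) ∈ feasDom f D S C p := by
  constructor
  · rintro ⟨hd, xs, us, rfl, hstep, hC⟩
    refine ⟨hd 0, us 0, (hstep 0).2, fun i => hd i.succ, Fin.tail xs, Fin.tail us,
      (hstep 0).1, fun t => hstep t.succ, hC⟩
  · rintro ⟨hd0, u, hu, hd, xs, us, hx0, hstep, hC⟩
    refine ⟨Fin.forall_fin_succ.2 ⟨hd0, hd⟩, Fin.cons x xs, Fin.cons u us, rfl,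
      Fin.forall_fin_succ.2 ⟨⟨hx0, hu⟩, fun t => hstep t⟩, hC⟩

theorem image_fst_feasDom {X U W : Type*} (f : X → U → W → X) (D : Set W) (S : Set (X × U))
    (C : Set X) (p : ℕ) :
    Prod.fst '' feasDom f D S C p = preN (dcDyn f) (dcSafe S D) p C := by
  induction p with
  | zero =>
    ext x
    constructor
    · rintro ⟨_, ⟨-, xs, -, h0, -, hC⟩, rfl⟩
      exact h0 ▸ hC
    · exact fun hx => ⟨(x, Fin.elim0), ⟨fun i => i.elim0, fun _ => x, Fin.elim0, rfl,
        fun t => t.elim0, hx⟩, rfl⟩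
  | succ p ih =>
    ext x
    rw [preN, ← ih]
    constructor
    · rintro ⟨⟨x, d⟩, h, rfl⟩
      obtain ⟨hd0, u, hu, h⟩ := mem_feasDom_succ.1 h
      exact ⟨(u, d 0), ⟨hu, hd0⟩, _, h, rfl⟩
    · rintro ⟨⟨u, d₀⟩, ⟨hu, hd₀⟩, ⟨_, d⟩, h, rfl⟩
      exact ⟨(x, Fin.cons d₀ d), mem_feasDom_succ.2 ⟨hd₀, u, hu, h⟩, rfl⟩

/-- **Lemma (projection of the MPC feasible domain).**
For a linear system and any set `C ⊆ ℝⁿ`,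
`π_n(ℱ_p(C)) = Pre^p_{𝒟(Σ)}(C, S_xu × D)`. -/
theorem proj_feasDom_eq_preN {n m l : ℕ}
    (A : Matrix (Fin n) (Fin n) ℝ) (B : Matrix (Fin n) (Fin m) ℝ)
    (E : Matrix (Fin n) (Fin l) ℝ)
    (D : Set (Fin l → ℝ)) (S : Set ((Fin n → ℝ) × (Fin m → ℝ)))
    (C : Set (Fin n → ℝ)) (p : ℕ) :
    Prod.fst '' (feasDom (linDyn A B E) D S C p) =
      preN (dcDyn (linDyn A B E)) (dcSafe S D) p C := by
  exact image_fst_feasDom _ D S C p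
end

section
/- Suppose Σ is linear, S_xu and D are convex and compact, C is an RCIS of Σ in S_xu, there is a forced equilibrium of 𝒟(Σ) at the origin in the interior of S_xu × D with 0 in the interior of C, and either 𝒟(Σ) is stabilizable or 𝒟(Σ) is controllable. Then the projection π_n(ℱ_p(C)) of the MPC feasible domain converges to C_{max,co} in Hausdorff distance as p → ∞, and there exist constants c > 0 and a ∈ [0,1) such that d_H(π_n(ℱ_p(C)), C_{max,co}) ≤ c a^p for all p ≥ 0. Consequently, d_H(π_n(ℱ_p(C)), π_n(C_{max,p})) ≤ c a^p, i.e., the gap between the projected feasible domain of the terminal-constraint MPC and the projected maximal feasible domain decays exponentially in the prediction horizon. -/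
open Set Pointwise

/-- An element of a complex Banach algebra whose spectrum lies in the open unit disc has powers
decaying geometrically. -/
theorem exists_norm_pow_le_of_spectrum_lt_one {R : Type*} [NormedRing R] [NormedAlgebra ℂ R]
    [CompleteSpace R] (x : R) (hx : ∀ μ ∈ spectrum ℂ x, ‖μ‖ < 1) :
    ∃ M a : ℝ, 0 ≤ M ∧ 0 < a ∧ a < 1 ∧ ∀ k : ℕ, ‖x ^ k‖ ≤ M * a ^ k := by
  have hr : spectralRadius ℂ x < 1 := by
    rcases (spectrum ℂ x).eq_empty_or_nonempty with h | h
    · simp [spectralRadius, h]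
    · exact spectrum.spectralRadius_lt_of_forall_lt_of_nonempty h (r := 1)
        fun k hk => by simpa [← NNReal.coe_lt_coe] using hx k hk
  obtain ⟨a, ha, ha1⟩ := ENNReal.lt_iff_exists_nnreal_btwn.1 hr
  have ha0 : (0 : ℝ) < a := by
    have : (0 : ENNReal) < a := lt_of_le_of_lt zero_le ha
    exact_mod_cast this
  have hev : ∀ᶠ k : ℕ in Filter.atTop, ‖x ^ k‖ ≤ 1 * ‖(a : ℝ) ^ k‖ := by
    filter_upwards [(spectrum.pow_nnnorm_pow_one_div_tendsto_nhds_spectralRadius x).eventually_lt_const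
      ha, Filter.eventually_gt_atTop 0] with k hk hk0
    have h1 : (‖x ^ k‖₊ : ENNReal) ≤ (a : ENNReal) ^ k := by
      have := pow_le_pow_left' hk.le k
      rwa [← ENNReal.rpow_natCast, ← ENNReal.rpow_mul,
        one_div_mul_cancel (by exact_mod_cast hk0.ne'), ENNReal.rpow_one] at this
    have h2 : ‖x ^ k‖₊ ≤ a ^ k := by exact_mod_cast h1
    have h3 : ‖x ^ k‖ ≤ (a : ℝ) ^ k := by exact_mod_cast h2
    simpa [abs_of_pos ha0] using h3
  obtain ⟨M, hM0, hM⟩ := Asymptotics.bound_of_isBigO_nat_atTop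
    (Asymptotics.IsBigO.of_bound 1 hev)
  refine ⟨M, a, hM0.le, ha0, by exact_mod_cast ha1, fun k => ?_⟩
  have := hM (x := k) (by positivity)
  simpa [abs_of_pos ha0] using this

theorem LinearMap.exists_norm_le_of_finiteDimensional {P Q : Type*} [NormedAddCommGroup P]
    [NormedSpace ℝ P] [FiniteDimensional ℝ P] [NormedAddCommGroup Q] [NormedSpace ℝ Q]
    (T : P →ₗ[ℝ] Q) : ∃ c : ℝ, 0 ≤ c ∧ ∀ x, ‖T x‖ ≤ c * ‖x‖ :=
  ⟨‖T.toContinuousLinearMap‖, norm_nonneg _, T.toContinuousLinearMap.le_opNorm⟩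

open scoped Matrix.Norms.Frobenius in
/-- A real Schur stable matrix has geometrically decaying powers, as operators on Euclidean
space. -/
theorem exists_norm_toEuclideanCLM_pow_le {n : ℕ} (A : Matrix (Fin n) (Fin n) ℝ)
    (hA : ∀ μ ∈ spectrum ℂ (A.map Complex.ofReal), ‖μ‖ < 1) :
    ∃ M a : ℝ, 0 ≤ M ∧ 0 < a ∧ a < 1 ∧
      ∀ k : ℕ, ‖(Matrix.toEuclideanCLM (𝕜 := ℝ) A) ^ k‖ ≤ M * a ^ k := by
  have : CompleteSpace (Matrix (Fin n) (Fin n) ℂ) := FiniteDimensional.complete ℂ _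
  obtain ⟨M, a, hM, ha0, ha1, h⟩ := exists_norm_pow_le_of_spectrum_lt_one _ hA
  obtain ⟨c, hc, hT⟩ := LinearMap.exists_norm_le_of_finiteDimensional
    (Matrix.toEuclideanCLM (n := Fin n) (𝕜 := ℝ)).toAlgEquiv.toLinearMap
  refine ⟨c * M, a, by positivity, ha0, ha1, fun k => ?_⟩
  have hmap : ‖A ^ k‖ = ‖(A.map Complex.ofReal) ^ k‖ := by
    have : (A.map Complex.ofReal) ^ k = (A ^ k).map Complex.ofReal :=
      (map_pow Complex.ofRealHom.mapMatrix A k).symm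
    rw [this, Matrix.frobenius_norm_map_eq _ _ (fun a => by simp)]
  rw [← map_pow]
  calc ‖Matrix.toEuclideanCLM (𝕜 := ℝ) (A ^ k)‖ ≤ c * ‖A ^ k‖ := hT _
    _ ≤ c * (M * a ^ k) := by rw [hmap]; gcongr; exact h k
    _ = c * M * a ^ k := by ring

section Steering

variable {X V : Type*} [NormedAddCommGroup X] [NormedSpace ℝ X]
  [NormedAddCommGroup V] [NormedSpace ℝ V]

/-- The system `x⁺ = F x + G v` admits linear open-loop controls driving every state to the origin
at a uniform geometric rate: `Y t x` and `Z t x` are the state and the input at time `t` when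
starting from `x`. -/
def LinearlySteerable (F : X →L[ℝ] X) (G : V →L[ℝ] X) : Prop :=
  ∃ (Y : ℕ → X →L[ℝ] X) (Z : ℕ → X →L[ℝ] V) (M a : ℝ),
    0 ≤ M ∧ 0 < a ∧ a < 1 ∧ (∀ x, Y 0 x = x) ∧
    (∀ t x, Y (t + 1) x = F (Y t x) + G (Z t x)) ∧
    (∀ t, ‖Y t‖ ≤ M * a ^ t) ∧ ∀ t, ‖Z t‖ ≤ M * a ^ t

theorem LinearlySteerable.of_feedback (F : X →L[ℝ] X) (G : V →L[ℝ] X) (K : X →L[ℝ] V) {M a : ℝ}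
    (hM : 0 ≤ M) (ha0 : 0 < a) (ha1 : a < 1) (h : ∀ k : ℕ, ‖(F + G.comp K) ^ k‖ ≤ M * a ^ k) :
    LinearlySteerable F G := by
  refine ⟨fun t => (F + G.comp K) ^ t, fun t => K.comp ((F + G.comp K) ^ t), (1 + ‖K‖) * M, a,
    by positivity, ha0, ha1, by simp, fun t x => by simp [pow_succ'], fun t => ?_, fun t => ?_⟩
  · calc _ ≤ M * a ^ t := h t
      _ ≤ (1 + ‖K‖) * M * a ^ t := by
        have : 0 ≤ ‖K‖ * M * a ^ t := by positivity
        linarith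
  · calc _ ≤ ‖K‖ * ‖(F + G.comp K) ^ t‖ := K.opNorm_comp_le _
      _ ≤ ‖K‖ * (M * a ^ t) := by gcongr; exact h t
      _ ≤ (1 + ‖K‖) * M * a ^ t := by
        have : 0 ≤ M * a ^ t := by positivity
        linarith

/-- State reached at time `t` from `x` under the linear open-loop inputs `Z`. -/
def openLoop (F : X →L[ℝ] X) (G : V →L[ℝ] X) (Z : ℕ → X →L[ℝ] V) : ℕ → X →L[ℝ] X
  | 0 => ContinuousLinearMap.id ℝ X
  | t + 1 => F.comp (openLoop F G Z t) + G.comp (Z t)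

theorem openLoop_eq (F : X →L[ℝ] X) (G : V →L[ℝ] X) (Z : ℕ → X →L[ℝ] V) (t : ℕ) (x : X) :
    openLoop F G Z t x =
      (F ^ t) x + ∑ j ∈ Finset.range t, (F ^ j) (G (Z (t - 1 - j) x)) := by
  induction t with
  | zero => simp [openLoop]
  | succ t ih =>
    rw [Finset.sum_range_succ']
    simp only [openLoop, add_apply, ContinuousLinearMap.comp_apply, ih,
      map_add, map_sum, pow_succ', mul_apply_eq_comp]
    simp [Nat.sub_sub, add_comm, add_left_comm]

theorem LinearlySteerable.of_controllable [FiniteDimensional ℝ X] (F : X →L[ℝ] X)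
    (G : V →L[ℝ] X) (n : ℕ)
    (h : Submodule.span ℝ {x | ∃ k < n, ∃ v, x = (F ^ k) (G v)} = ⊤) :
    LinearlySteerable F G := by
  let R : (Fin n → V) →ₗ[ℝ] X :=
    ∑ k : Fin n, ((F ^ (k : ℕ)).comp G).toLinearMap ∘ₗ LinearMap.proj k
  have hR : ∀ w, R w = ∑ k : Fin n, (F ^ (k : ℕ)) (G (w k)) := fun w => by
    simp only [R, LinearMap.sum_apply]
    rfl
  have hsurj : LinearMap.range R = ⊤ := by
    rw [eq_top_iff, ← h, Submodule.span_le]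
    rintro _ ⟨k, hk, v, rfl⟩
    refine ⟨Pi.single ⟨k, hk⟩ v, ?_⟩
    rw [hR, Finset.sum_eq_single ⟨k, hk⟩]
    · simp
    · intro b _ hb
      simp [Pi.single_eq_of_ne hb]
    · simp
  obtain ⟨L, hL⟩ := R.exists_rightInverse_of_surjective hsurj
  let Z : ℕ → X →L[ℝ] V := fun t =>
    if ht : t < n then
      -((LinearMap.proj (⟨n - 1 - t, by omega⟩ : Fin n) ∘ₗ L).toContinuousLinearMap.comp (F ^ n))
    else 0
  have hZ : ∀ t, n ≤ t → Z t = 0 := fun t ht => by simp [Z, ht.not_gt]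
  have hYn : openLoop F G Z n = 0 := by
    ext x
    rw [openLoop_eq, ← Fin.sum_univ_eq_sum_range fun j => (F ^ j) (G (Z (n - 1 - j) x))]
    have : ∀ k : Fin n, (F ^ (k : ℕ)) (G (Z (n - 1 - k) x)) =
        -(F ^ (k : ℕ)) (G (L ((F ^ n) x) k)) := fun k => by
      have h1 : n - 1 - (k : ℕ) < n := by have := k.2; omega
      have h2 : (⟨n - 1 - (n - 1 - (k : ℕ)), by have := k.2; omega⟩ : Fin n) = k :=
        Fin.ext (by have := k.2; simp only []; omega)
      simp [Z, h1, h2]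
    rw [Finset.sum_congr rfl fun k _ => this k, Finset.sum_neg_distrib, ← hR]
    have := LinearMap.congr_fun hL ((F ^ n) x)
    simp only [LinearMap.comp_apply, LinearMap.id_apply] at this
    rw [this, add_neg_cancel, zero_apply]
  have hY : ∀ t, n ≤ t → openLoop F G Z t = 0 := fun t ht => by
    induction t, ht using Nat.le_induction with
    | base => exact hYn
    | succ t ht ih => simp [openLoop, ih, hZ t ht]
  let N : ℝ := ∑ t ∈ Finset.range n, (‖openLoop F G Z t‖ + ‖Z t‖)
  have hN0 : 0 ≤ N := by positivity
  have hN : ∀ t < n, ‖openLoop F G Z t‖ + ‖Z t‖ ≤ N := fun t ht =>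
    Finset.single_le_sum (f := fun t => ‖openLoop F G Z t‖ + ‖Z t‖)
      (fun _ _ => by positivity) (Finset.mem_range.2 ht)
  have hNt : ∀ t < n, N ≤ N * 2 ^ n * (1 / 2) ^ t := fun t ht => by
    have : (1 : ℝ) ≤ 2 ^ n * (1 / 2) ^ t := by
      rw [one_div, inv_pow, ← div_eq_mul_inv, one_le_div (by positivity)]
      exact pow_le_pow_right₀ one_le_two ht.le
    rw [mul_assoc]
    exact le_mul_of_one_le_right hN0 this
  refine ⟨openLoop F G Z, Z, N * 2 ^ n, 1 / 2, by positivity, by norm_num, by norm_num,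
    fun x => by simp [openLoop], fun t x => by simp [openLoop], fun t => ?_, fun t => ?_⟩
  · rcases lt_or_ge t n with ht | ht
    · linarith [hN t ht, hNt t ht, norm_nonneg (Z t)]
    · rw [hY t ht, norm_zero]; positivity
  · rcases lt_or_ge t n with ht | ht
    · linarith [hN t ht, hNt t ht, norm_nonneg (openLoop F G Z t)]
    · rw [hZ t ht, norm_zero]; positivity

/-- Bound on the response at time `t` to perturbations growing like `μ ^ j` filtered by a kernel
decaying like `a ^ j`. -/
theorem norm_sum_smul_kernel_le {Q : Type*} [NormedAddCommGroup Q] [NormedSpace ℝ Q]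
    (L : ℕ → X →L[ℝ] Q) {M a μ ε R : ℝ} (hM : 0 ≤ M) (ha : 0 < a) (haμ : a < μ) (hμ : 1 ≤ μ)
    (hε : 0 ≤ ε) (hL : ∀ t, ‖L t‖ ≤ M * a ^ t) (x : ℕ → X) (hx : ∀ t, ‖x t‖ ≤ R) (t : ℕ) :
    ‖∑ j ∈ Finset.range t, (ε * (μ ^ (j + 1) - μ ^ j)) • L (t - 1 - j) (x (j + 1))‖ ≤
      ε * μ ^ t * (M * R * (μ - 1) / (μ - a)) := by
  have hR : 0 ≤ R := (norm_nonneg _).trans (hx 0)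
  have hμ0 : 0 ≤ μ := by linarith
  have hd : 0 < μ - a := by linarith
  calc _ ≤ ∑ j ∈ Finset.range t, ε * (μ - 1) * M * R * (μ ^ j * a ^ (t - 1 - j)) := by
        refine norm_sum_le_of_le _ fun j _ => ?_
        have h1 : 0 ≤ ε * (μ ^ (j + 1) - μ ^ j) := by
          have : μ ^ j ≤ μ ^ (j + 1) := pow_le_pow_right₀ hμ (Nat.le_succ j)
          exact mul_nonneg hε (by linarith)
        rw [norm_smul, Real.norm_of_nonneg h1]
        calc _ ≤ ε * (μ ^ (j + 1) - μ ^ j) * (M * a ^ (t - 1 - j) * R) := by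
              gcongr
              exact ((L _).le_opNorm _).trans
                (mul_le_mul (hL _) (hx _) (norm_nonneg _) (by positivity))
          _ = _ := by ring
    _ = ε * (μ - 1) * M * R * ((μ ^ t - a ^ t) / (μ - a)) := by
        rw [← Finset.mul_sum]
        congr 1
        rw [eq_div_iff hd.ne', geom_sum₂_mul]
    _ ≤ ε * (μ - 1) * M * R * (μ ^ t / (μ - a)) := by
        have : 0 ≤ μ - 1 := by linarith
        have : 0 ≤ a ^ t := by positivity
        gcongr
        linarith
    _ = _ := by ring

/-- Every bounded admissible trajectory of a linearly steerable system can be modified, after an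
exponentially small shrinking of the initial state, into an admissible trajectory that is close to
the origin after `p` steps. -/
theorem LinearlySteerable.exists_steering {F : X →L[ℝ] X} {G : V →L[ℝ] X}
    (hFG : LinearlySteerable F G) {S : Set (X × V)} (hS : Convex ℝ S) {r : ℝ} (hr : 0 < r)
    (hrS : ∀ x v, ‖x‖ ≤ r → ‖v‖ ≤ r → (x, v) ∈ S) {R : ℝ} (hR : 0 ≤ R) :
    ∃ b : ℝ, 0 < b ∧ b < 1 ∧ ∀ (x : ℕ → X) (v : ℕ → V),
      (∀ t, x (t + 1) = F (x t) + G (v t)) → (∀ t, (x t, v t) ∈ S) → (∀ t, ‖x t‖ ≤ R) →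
      ∀ p : ℕ, ∃ (z : ℕ → X) (w : ℕ → V), z 0 = (1 - b ^ p) • x 0 ∧
        (∀ t, z (t + 1) = F (z t) + G (w t)) ∧ (∀ t ≤ p, (z t, w t) ∈ S) ∧ ‖z p‖ ≤ r := by
  obtain ⟨Y, Z, M, a, hM, ha0, ha1, hY0, hYZ, hY, hZ⟩ := hFG
  have hs : 0 < r * (1 - a) / (M * R + 1) := by
    have : 0 < 1 - a := by linarith
    positivity
  set μ : ℝ := 1 + r * (1 - a) / (M * R + 1) with hμdef
  have hμ : 1 < μ := by linarith
  have hμ0 : 0 < μ := by linarith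
  have hκ : M * R * (μ - 1) / (μ - a) ≤ r := by
    rw [div_le_iff₀ (by linarith)]
    have h1 : M * R * (μ - 1) ≤ r * (1 - a) := by
      have : (M * R + 1) * (μ - 1) = r * (1 - a) := by
        rw [hμdef]; field_simp; ring
      linarith
    nlinarith
  refine ⟨μ⁻¹, by positivity, inv_lt_one_of_one_lt₀ hμ, fun x v hdyn hxS hxR p => ?_⟩
  set ε : ℝ := μ⁻¹ ^ p with hε
  have hε0 : 0 < ε := by positivity
  have hεμ : ∀ t ≤ p, ε * μ ^ t ≤ 1 := fun t ht => by
    rw [hε, inv_pow, inv_mul_le_one₀ (by positivity)]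
    exact pow_le_pow_right₀ hμ.le ht
  have hεp : ε * μ ^ p = 1 := by
    rw [hε, inv_pow, inv_mul_cancel₀ (by positivity)]
  let y : ℕ → X := fun t =>
    ∑ j ∈ Finset.range t, (ε * (μ ^ (j + 1) - μ ^ j)) • Y (t - 1 - j) (x (j + 1))
  let q : ℕ → V := fun t =>
    ∑ j ∈ Finset.range t, (ε * (μ ^ (j + 1) - μ ^ j)) • Z (t - 1 - j) (x (j + 1))
  have hyb : ∀ t, ‖y t‖ ≤ ε * μ ^ t * r := fun t =>
    (norm_sum_smul_kernel_le Y hM ha0 (ha1.trans hμ) hμ.le hε0.le hY x hxR t).trans (by gcongr)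
  have hqb : ∀ t, ‖q t‖ ≤ ε * μ ^ t * r := fun t =>
    (norm_sum_smul_kernel_le Z hM ha0 (ha1.trans hμ) hμ.le hε0.le hZ x hxR t).trans (by gcongr)
  have hysucc : ∀ t, y (t + 1) =
      F (y t) + G (q t) + (ε * (μ ^ (t + 1) - μ ^ t)) • x (t + 1) := fun t => by
    simp only [y, q, map_sum, map_smul]
    rw [Finset.sum_range_succ, ← Finset.sum_add_distrib]
    congr 1
    · refine Finset.sum_congr rfl fun j hj => ?_
      have hj' := Finset.mem_range.1 hj
      rw [show t + 1 - 1 - j = t - 1 - j + 1 by omega, hYZ, smul_add]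
    · simp [hY0]
  refine ⟨fun t => (1 - ε * μ ^ t) • x t + y t, fun t => (1 - ε * μ ^ t) • v t + q t,
    by simp [y], fun t => ?_, fun t ht => ?_, ?_⟩
  · simp only [hysucc, map_add, map_smul, hdyn]
    module
  · have hpos : 0 < ε * μ ^ t := by positivity
    have hball : ((ε * μ ^ t)⁻¹ • y t, (ε * μ ^ t)⁻¹ • q t) ∈ S := by
      refine hrS _ _ ?_ ?_ <;>
        rw [norm_smul, norm_inv, Real.norm_of_nonneg hpos.le, inv_mul_le_iff₀ hpos]
      exacts [hyb t, hqb t]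
    have := hS (hxS t) hball (sub_nonneg.2 (hεμ t ht)) hpos.le (by ring)
    simpa only [Prod.smul_mk, Prod.mk_add_mk, smul_inv_smul₀ hpos.ne'] using this
  · simpa [hεp] using hyb p

end Steering

section Feasibility

variable {X U W : Type*} {f : X → U → W → X} {D : Set W} {S : Set (X × U)} {C : Set X}

/-- The feasible domain with an RCIS as terminal set is an RCIS of the augmented system. -/
theorem isRCIS_feasDom (hC : IsRCIS f D S C) (p : ℕ) :
    IsRCIS (augDyn f p) D (augSafe S D p) (feasDom f D S C p) := by
  rintro ⟨x, d⟩ ⟨hd, xs, us, h0, hstep, hlast⟩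
  simp only at h0 hd hstep
  rcases p with _ | p
  · obtain ⟨u, hu, hinv⟩ := hC x (by rw [← h0]; exact hlast)
    refine ⟨u, ⟨hu, hd⟩, fun e he => ⟨fun i => i.elim0, fun _ => f x u e, fun i => i.elim0, ?_,
      fun i => i.elim0, hinv e he⟩⟩
    simp [augDyn]
  · obtain ⟨u, hu, hinv⟩ := hC _ hlast
    refine ⟨us 0, ⟨by simpa [← h0] using (hstep 0).2, hd⟩, fun e he => ⟨fun i => ?_, ?_⟩⟩
    · simp only [augDyn]
      split_ifs
      exacts [hd _, he]
    · refine ⟨Fin.snoc (fun i : Fin (p + 1) => xs i.succ) (f (xs (Fin.last (p + 1))) u e),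
        Fin.snoc (fun i : Fin p => us i.succ) u, ?_, fun t => ?_, ?_⟩
      · have h := (hstep 0).1
        simp only [Fin.castSucc_zero, h0] at h
        rw [← Fin.castSucc_zero, Fin.snoc_castSucc, h]
        simp [augDyn]
      · refine Fin.lastCases ?_ (fun t => ?_) t
        · rw [Fin.succ_last, Fin.snoc_last, Fin.snoc_last, Fin.snoc_castSucc, Fin.succ_last]
          exact ⟨by simp [augDyn], hu⟩
        · have h := hstep t.succ
          rw [← Fin.castSucc_succ, Fin.snoc_castSucc, Fin.snoc_castSucc, Fin.snoc_castSucc]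
          refine ⟨?_, h.2⟩
          rw [h.1]
          simp [augDyn]
          rfl
      · rw [Fin.snoc_last]
        exact hinv e he

/-- The projection of an RCIS of the augmented system is a CIS of the collaborative system. -/
theorem IsRCIS.isCIS_image_fst {p : ℕ} {T : Set (X × (Fin p → W))} (hD : D.Nonempty)
    (hT : IsRCIS (augDyn f p) D (augSafe S D p) T) :
    IsCIS (dcDyn f) (dcSafe S D) (Prod.fst '' T) := by
  rintro _ ⟨⟨x, d⟩, hxd, rfl⟩
  obtain ⟨u, ⟨hu, hd⟩, hinv⟩ := hT _ hxd
  obtain ⟨e, he⟩ := hD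
  refine ⟨(u, if h : 0 < p then d ⟨0, h⟩ else e), ⟨hu, ?_⟩, ⟨_, hinv e he, rfl⟩⟩
  simp only
  split_ifs
  exacts [hd _, he]

/-- A CIS yields infinite admissible trajectories. -/
theorem IsCIS.exists_trajectory {V : Type*} {g : X → V → X} {T : Set (X × V)} (hC : IsCIS g T C)
    {x₀ : X} (hx₀ : x₀ ∈ C) :
    ∃ (x : ℕ → X) (v : ℕ → V), x 0 = x₀ ∧ (∀ t, x (t + 1) = g (x t) (v t)) ∧
      ∀ t, (x t, v t) ∈ T := by
  have : Nonempty V := ⟨(hC _ hx₀).choose⟩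
  choose! k hk hk' using hC
  let x : ℕ → X := fun t => (fun y => g y (k y))^[t] x₀
  have hx : ∀ t, x t ∈ C := fun t => by
    induction t with
    | zero => exact hx₀
    | succ t ih =>
      simp only [x, Function.iterate_succ_apply'] at ih ⊢
      exact hk' _ ih
  exact ⟨x, fun t => k (x t), rfl, fun t => by simp [x, Function.iterate_succ_apply'],
    fun t => hk _ (hx t)⟩

theorem mem_image_fst_feasDom {p : ℕ} (z : ℕ → X) (w : ℕ → U × W)
    (hdyn : ∀ t, z (t + 1) = dcDyn f (z t) (w t)) (hS : ∀ t ≤ p, (z t, w t) ∈ dcSafe S D)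
    (hp : z p ∈ C) : z 0 ∈ Prod.fst '' feasDom f D S C p :=
  ⟨(z 0, fun i => (w i).2), ⟨fun i => (hS i i.2.le).2, fun i => z i, fun i => (w i).1, by simp,
    fun t => ⟨by simpa [dcDyn] using hdyn t, (hS t t.2.le).1⟩, by simpa using hp⟩, rfl⟩

theorem Convex.dcSafe {X U W : Type*} [AddCommGroup X] [Module ℝ X] [AddCommGroup U] [Module ℝ U]
    [AddCommGroup W] [Module ℝ W] {S : Set (X × U)} {D : Set W} (hS : Convex ℝ S)
    (hD : Convex ℝ D) : Convex ℝ (dcSafe S D) :=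
  fun _ hx _ hy _ _ ha hb hab => ⟨hS hx.1 hy.1 ha hb hab, hD hx.2 hy.2 ha hb hab⟩

end Feasibility

section Euclidean

variable {n m l : ℕ} (A : Matrix (Fin n) (Fin n) ℝ) (B : Matrix (Fin n) (Fin m) ℝ)
  (E : Matrix (Fin n) (Fin l) ℝ)

/-- Joint input map `(u, d) ↦ B u + E d` of the collaborative system. -/
noncomputable def jointInput :
    EuclideanSpace ℝ (Fin m) × EuclideanSpace ℝ (Fin l) →L[ℝ] EuclideanSpace ℝ (Fin n) :=
  (Matrix.toLpLin 2 2 B).toContinuousLinearMap.coprod (Matrix.toLpLin 2 2 E).toContinuousLinearMap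

theorem dcDyn_linDynE_apply (x : EuclideanSpace ℝ (Fin n))
    (v : EuclideanSpace ℝ (Fin m) × EuclideanSpace ℝ (Fin l)) :
    dcDyn (linDynE A B E) x v = Matrix.toEuclideanCLM (𝕜 := ℝ) A x + jointInput B E v := by
  ext i
  simp [dcDyn, linDynE, jointInput, Matrix.toLpLin_apply, add_assoc]
  rfl

theorem linearlySteerable_of_stabilizable (K₁ : Matrix (Fin m) (Fin n) ℝ)
    (K₂ : Matrix (Fin l) (Fin n) ℝ)
    (h : ∀ μ ∈ spectrum ℂ ((A + B * K₁ + E * K₂).map (Complex.ofReal)), ‖μ‖ < 1) :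
    LinearlySteerable (Matrix.toEuclideanCLM (𝕜 := ℝ) A) (jointInput B E) := by
  obtain ⟨M, a, hM, ha0, ha1, hb⟩ := exists_norm_toEuclideanCLM_pow_le _ h
  refine .of_feedback _ _ ((Matrix.toLpLin 2 2 K₁).toContinuousLinearMap.prod
    (Matrix.toLpLin 2 2 K₂).toContinuousLinearMap) hM ha0 ha1 fun k => ?_
  convert hb k using 3
  ext x i
  simp [jointInput, Matrix.toLpLin_apply, add_assoc]

theorem linearlySteerable_of_controllable
    (h : Submodule.span ℝ
      {v : Fin n → ℝ | ∃ k : ℕ, k < n ∧ ∃ (w : Fin m → ℝ) (z : Fin l → ℝ),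
        v = (A ^ k).mulVec (B.mulVec w + E.mulVec z)} = ⊤) :
    LinearlySteerable (Matrix.toEuclideanCLM (𝕜 := ℝ) A) (jointInput B E) := by
  refine .of_controllable _ _ n ?_
  have := congrArg (Submodule.map (WithLp.linearEquiv 2 ℝ (Fin n → ℝ)).symm.toLinearMap) h
  rw [Submodule.map_span, Submodule.map_top, LinearEquiv.range] at this
  rw [eq_top_iff, ← this, Submodule.span_le]
  rintro _ ⟨_, ⟨k, hk, w, z, rfl⟩, rfl⟩
  refine Submodule.subset_span ⟨k, hk, (WithLp.toLp 2 w, WithLp.toLp 2 z), ?_⟩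
  rw [← map_pow]
  rfl

end Euclidean

/-- **Theorem (exponential convergence of the projected MPC feasible domain).**
Under convexity/compactness, an interior forced equilibrium at the origin with `0` in
the interior of the terminal RCIS `C`, and stabilizability or controllability of
`𝒟(Σ)`, the projection `π_n(ℱ_p(C))` converges to `C_{max,co}` in Hausdorff distance,
with `d_H(π_n(ℱ_p(C)), C_{max,co}) ≤ c aᵖ` and hence
`d_H(π_n(ℱ_p(C)), π_n(C_{max,p})) ≤ c aᵖ` for some `c > 0`, `a ∈ [0,1)`. -/
theorem proj_feasDom_exponential_convergence {n m l : ℕ}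
    (A : Matrix (Fin n) (Fin n) ℝ) (B : Matrix (Fin n) (Fin m) ℝ)
    (E : Matrix (Fin n) (Fin l) ℝ)
    (D : Set (EuclideanSpace ℝ (Fin l)))
    (S : Set (EuclideanSpace ℝ (Fin n) × EuclideanSpace ℝ (Fin m)))
    (hDconv : Convex ℝ D) (hDcpt : IsCompact D)
    (hSconv : Convex ℝ S) (hScpt : IsCompact S)
    (C : Set (EuclideanSpace ℝ (Fin n)))
    (hC : IsRCIS (linDynE A B E) D S C)
    (h0int : ((0 : EuclideanSpace ℝ (Fin n)),
      ((0 : EuclideanSpace ℝ (Fin m)), (0 : EuclideanSpace ℝ (Fin l)))) ∈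
      interior (dcSafe S D))
    (h0C : (0 : EuclideanSpace ℝ (Fin n)) ∈ interior C)
    (hsys : (∃ (K₁ : Matrix (Fin m) (Fin n) ℝ) (K₂ : Matrix (Fin l) (Fin n) ℝ),
        ∀ μ ∈ spectrum ℂ ((A + B * K₁ + E * K₂).map (Complex.ofReal)), ‖μ‖ < 1) ∨
      Submodule.span ℝ
        {v : Fin n → ℝ | ∃ k : ℕ, k < n ∧ ∃ (w : Fin m → ℝ) (z : Fin l → ℝ),
          v = (A ^ k).mulVec (B.mulVec w + E.mulVec z)} = ⊤)
    (Cfam : (q : ℕ) → Set (EuclideanSpace ℝ (Fin n) × (Fin q → EuclideanSpace ℝ (Fin l))))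
    (hCfam : ∀ q : ℕ, IsMaxRCIS (augDyn (linDynE A B E) q) D (augSafe S D q) (Cfam q))
    (Cco : Set (EuclideanSpace ℝ (Fin n)))
    (hCco : IsMaxCIS (dcDyn (linDynE A B E)) (dcSafe S D) Cco) :
    Filter.Tendsto
      (fun p : ℕ =>
        Metric.hausdorffDist (Prod.fst '' (feasDom (linDynE A B E) D S C p)) Cco)
      Filter.atTop (nhds 0) ∧
    ∃ c : ℝ, 0 < c ∧ ∃ a : ℝ, 0 ≤ a ∧ a < 1 ∧ ∀ p : ℕ,
      Metric.hausdorffDist (Prod.fst '' (feasDom (linDynE A B E) D S C p)) Cco ≤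
        c * a ^ p ∧
      Metric.hausdorffDist (Prod.fst '' (feasDom (linDynE A B E) D S C p))
        (Prod.fst '' (Cfam p)) ≤ c * a ^ p := by
  have hsteer : LinearlySteerable (Matrix.toEuclideanCLM (𝕜 := ℝ) A) (jointInput B E) := by
    rcases hsys with ⟨K₁, K₂, h⟩ | h
    exacts [linearlySteerable_of_stabilizable A B E K₁ K₂ h,
      linearlySteerable_of_controllable A B E h]
  have h0D : (0 : EuclideanSpace ℝ (Fin l)) ∈ D := (interior_subset h0int).2
  obtain ⟨R₀, hR₀⟩ := hScpt.isBounded.exists_norm_le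
  set R := max R₀ 0
  have hSR : ∀ x u, (x, u) ∈ S → ‖x‖ ≤ R := fun x u h =>
    (norm_fst_le (x, u)).trans ((hR₀ _ h).trans (le_max_left _ _))
  have hR : 0 ≤ R := le_max_right _ _
  obtain ⟨r₁, hr₁, hball₁⟩ := Metric.nhds_basis_closedBall.mem_iff.1
    (mem_interior_iff_mem_nhds.1 h0int)
  obtain ⟨r₂, hr₂, hball₂⟩ := Metric.nhds_basis_closedBall.mem_iff.1
    (mem_interior_iff_mem_nhds.1 h0C)
  obtain ⟨b, hb0, hb1, hb⟩ := hsteer.exists_steering (hSconv.dcSafe hDconv) (lt_min hr₁ hr₂)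
    (fun x v hx hv => hball₁ (by
      rw [mem_closedBall_iff_norm]
      simpa [Prod.norm_def] using And.intro (hx.trans (min_le_left _ _))
        (hv.trans (min_le_left _ _)))) hR
  have happrox : ∀ p, ∀ x ∈ Cco, ∃ y ∈ Prod.fst '' feasDom (linDynE A B E) D S C p,
      dist x y ≤ (R + 1) * b ^ p := fun p x₀ hx₀ => by
    obtain ⟨x, v, rfl, hdyn, hxS⟩ := hCco.1.exists_trajectory hx₀
    have hxR : ∀ t, ‖x t‖ ≤ R := fun t => hSR _ _ (hxS t).1
    obtain ⟨z, w, hz0, hzdyn, hzS, hzp⟩ := hb x v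
      (fun t => by rw [hdyn, dcDyn_linDynE_apply]) hxS hxR p
    refine ⟨z 0, mem_image_fst_feasDom z w (fun t => by rw [hzdyn, dcDyn_linDynE_apply]) hzS
      (hball₂ (by simpa using hzp.trans (min_le_right _ _))), ?_⟩
    have hbp : 0 ≤ b ^ p := by positivity
    rw [hz0, dist_eq_norm, show x 0 - (1 - b ^ p) • x 0 = b ^ p • x 0 by module, norm_smul,
      Real.norm_of_nonneg hbp]
    nlinarith [hxR 0]
  have hsub : ∀ p, Prod.fst '' feasDom (linDynE A B E) D S C p ⊆ Prod.fst '' Cfam p := fun p =>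
    Set.image_mono ((hCfam p).2 _ (isRCIS_feasDom hC p))
  have hsub' : ∀ p, Prod.fst '' Cfam p ⊆ Cco := fun p =>
    hCco.2 _ ((hCfam p).1.isCIS_image_fst ⟨0, h0D⟩)
  have hdist : ∀ p T, Prod.fst '' feasDom (linDynE A B E) D S C p ⊆ T → T ⊆ Cco →
      Metric.hausdorffDist (Prod.fst '' feasDom (linDynE A B E) D S C p) T ≤ (R + 1) * b ^ p :=
    fun p T h₁ h₂ => by
      have hnn : 0 ≤ (R + 1) * b ^ p := by positivity
      exact Metric.hausdorffDist_le_of_mem_dist hnn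
        (fun x hx => ⟨x, h₁ hx, by simpa using hnn⟩) fun x hx => happrox p x (h₂ hx)
  have hmain := fun p => hdist p Cco ((hsub p).trans (hsub' p)) subset_rfl
  refine ⟨squeeze_zero (fun _ => Metric.hausdorffDist_nonneg) hmain ?_,
    R + 1, by positivity, b, hb0.le, hb1, fun p => ⟨hmain p, hdist p _ (hsub p) (hsub' p)⟩⟩
  simpa using (tendsto_pow_atTop_nhds_zero_of_lt_one hb0.le hb1).const_mul (R + 1)
end

section
/- For a linear system 𝒟(Σ): x⁺ = Ax + Bu + Eu_d with convex safe set S ⊆ ℝ^{n+m+l}, any convex set C ⊆ ℝ^n, any a, b ∈ [0,1], and any N ≥ 1, the N-step backward reachable sets satisfy the superadditivity relation Pre^N_{𝒟(Σ)}(C, S) ⊇ Pre^N_{𝒟(Σ)}(aC, bS) + Pre^N_{𝒟(Σ)}((1−a)C, (1−b)S), where + denotes Minkowski sum. Moreover, for any set C and any scalar a > 0, Pre^N_{𝒟(Σ)}(C, S) = (1/a) Pre^N_{𝒟(Σ)}(aC, aS). -/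
open Set Pointwise

/-- Backward reachable sets of a system with additive dynamics are superadditive in the pair
(safe set, target). -/
theorem preN_add_subset {X V : Type*} [Add X] [Add V] {g : X → V → X}
    (hg : ∀ x y u v, g (x + y) (u + v) = g x u + g y v) {S₁ S₂ S : Set (X × V)}
    (hS : S₁ + S₂ ⊆ S) {T₁ T₂ T : Set X} (hT : T₁ + T₂ ⊆ T) (k : ℕ) :
    preN g S₁ k T₁ + preN g S₂ k T₂ ⊆ preN g S k T := by
  induction k with
  | zero => exact hT
  | succ k ih =>
    rintro _ ⟨x, ⟨u, hu, hxu⟩, y, ⟨v, hv, hyv⟩, rfl⟩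
    refine ⟨u + v, hS (Set.add_mem_add hu hv), ?_⟩
    rw [hg]
    exact ih (Set.add_mem_add hxu hyv)

/-- Scaling a backward reachable set of a system with homogeneous dynamics. -/
theorem smul_preN_subset {R X V : Type*} [SMul R X] [SMul R V] {g : X → V → X} {c : R}
    (hg : ∀ x u, g (c • x) (c • u) = c • g x u) (S : Set (X × V)) (T : Set X) (k : ℕ) :
    c • preN g S k T ⊆ preN g (c • S) k (c • T) := by
  induction k with
  | zero => exact subset_rfl
  | succ k ih =>
    rintro _ ⟨x, ⟨u, hu, hxu⟩, rfl⟩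
    refine ⟨c • u, Set.smul_mem_smul_set hu, ?_⟩
    rw [hg]
    exact ih (Set.smul_mem_smul_set hxu)

theorem dcDyn_linDyn_add {n m l : ℕ} (A : Matrix (Fin n) (Fin n) ℝ)
    (B : Matrix (Fin n) (Fin m) ℝ) (E : Matrix (Fin n) (Fin l) ℝ) (x y : Fin n → ℝ)
    (u v : (Fin m → ℝ) × (Fin l → ℝ)) :
    dcDyn (linDyn A B E) (x + y) (u + v) =
      dcDyn (linDyn A B E) x u + dcDyn (linDyn A B E) y v := by
  simp only [dcDyn, linDyn, Prod.fst_add, Prod.snd_add, Matrix.mulVec_add]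
  abel

theorem dcDyn_linDyn_smul {n m l : ℕ} (A : Matrix (Fin n) (Fin n) ℝ)
    (B : Matrix (Fin n) (Fin m) ℝ) (E : Matrix (Fin n) (Fin l) ℝ) (c : ℝ) (x : Fin n → ℝ)
    (u : (Fin m → ℝ) × (Fin l → ℝ)) :
    dcDyn (linDyn A B E) (c • x) (c • u) = c • dcDyn (linDyn A B E) x u := by
  simp only [dcDyn, linDyn, Prod.smul_fst, Prod.smul_snd, Matrix.mulVec_smul, smul_add]

/-- **Superadditivity and positive homogeneity of backward reachable sets** for the
linear system `𝒟(Σ) : x⁺ = Ax + Bu + Eu_d` with convex safe set `S`: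
`Pre^N(C,S) ⊇ Pre^N(aC, bS) + Pre^N((1-a)C, (1-b)S)` for convex `C` and
`a, b ∈ [0,1]`, and `Pre^N(C,S) = (1/a) Pre^N(aC, aS)` for any `C` and `a > 0`. -/
theorem preN_superadditive_and_homogeneous {n m l : ℕ}
    (A : Matrix (Fin n) (Fin n) ℝ) (B : Matrix (Fin n) (Fin m) ℝ)
    (E : Matrix (Fin n) (Fin l) ℝ)
    (S : Set ((Fin n → ℝ) × ((Fin m → ℝ) × (Fin l → ℝ)))) (hSconv : Convex ℝ S)
    (N : ℕ) (hN : 0 < N) :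
    (∀ C : Set (Fin n → ℝ), Convex ℝ C → ∀ a b : ℝ,
      0 ≤ a → a ≤ 1 → 0 ≤ b → b ≤ 1 →
      preN (dcDyn (linDyn A B E)) (b • S) N (a • C) +
          preN (dcDyn (linDyn A B E)) ((1 - b) • S) N ((1 - a) • C) ⊆
        preN (dcDyn (linDyn A B E)) S N C) ∧
    (∀ C : Set (Fin n → ℝ), ∀ a : ℝ, 0 < a →
      preN (dcDyn (linDyn A B E)) S N C =
        (1 / a) • preN (dcDyn (linDyn A B E)) (a • S) N (a • C)) := by
  refine ⟨fun C hC a b ha ha' hb hb' => ?_, fun C a ha => ?_⟩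
  · exact preN_add_subset (dcDyn_linDyn_add A B E)
      ((convex_iff_pointwise_add_subset.1 hSconv) hb (sub_nonneg.2 hb') (add_sub_cancel b 1))
      ((convex_iff_pointwise_add_subset.1 hC) ha (sub_nonneg.2 ha') (add_sub_cancel a 1)) N
  · rw [one_div]
    apply Set.Subset.antisymm
    · rw [Set.subset_smul_set_iff₀ (inv_ne_zero ha.ne'), inv_inv]
      exact smul_preN_subset (dcDyn_linDyn_smul A B E a) S C N
    · have h := smul_preN_subset (dcDyn_linDyn_smul A B E a⁻¹) (a • S) (a • C) N
      rwa [inv_smul_smul₀ ha.ne', inv_smul_smul₀ ha.ne'] at h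
end

section
/- Consider the scalar system x(t+1) = a x(t) + u(t) + d(t) with d(t) ∈ [−d̄, d̄], safe set S_xu = [−x̄, x̄] × [−ū, ū], and parameters satisfying a > 1, x̄ ≥ (ū + d̄)/(a−1), and a^{p−1} ū ≥ d̄. Then the maximal RCIS of the p-augmented system in the safe set [−x̄,x̄] × [−d̄,d̄]^p × [−ū,ū] is C_{max,p} = {(x, d_{1:p}) | |d_i| ≤ d̄ for all i ∈ {1,…,p}, and |x + Σ_{i=1}^{p} d_i/a^i| ≤ (ū − d̄/a^p)/(a−1)}; its projection onto the first coordinate is the interval [−(ū + d̄ − 2d̄/a^p)/(a−1), (ū + d̄ − 2d̄/a^p)/(a−1)]; the maximal CIS of the disturbance collaborative system x⁺ = ax + u with safe set [−x̄,x̄] × [−ū−d̄, ū+d̄] is [−(ū+d̄)/(a−1), (ū+d̄)/(a−1)]; and the Hausdorff distance between the projection and this maximal CIS equals 2d̄/((a−1)a^p). -/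
open Set Pointwise

/-- A function that is bounded above on `C` and can be expanded by `a > 1` inside `C` is
nonpositive on `C`. -/
lemma nonpos_of_expanding {α : Type*} {C : Set α} {g : α → ℝ} {a K : ℝ} (ha : 1 < a)
    (hK : ∀ s ∈ C, g s ≤ K) (hstep : ∀ s ∈ C, ∃ s' ∈ C, a * g s ≤ g s') :
    ∀ s ∈ C, g s ≤ 0 := by
  have hpow : ∀ n : ℕ, ∀ s ∈ C, a ^ n * g s ≤ K := by
    intro n
    induction n with
    | zero => simpa using hK
    | succ n ih =>
      intro s hs
      obtain ⟨s', hs', h⟩ := hstep s hs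
      calc a ^ (n + 1) * g s = a ^ n * (a * g s) := by ring
        _ ≤ a ^ n * g s' := by gcongr
        _ ≤ K := ih s' hs'
  intro s hs
  by_contra! h
  obtain ⟨n, hn⟩ := pow_unbounded_of_one_lt (K / g s) ha
  rw [div_lt_iff₀ h] at hn
  exact absurd (hpow n s hs) (not_le.mpr hn)

/-- The state of the augmented system with the previewed disturbances discounted back to the
current time. -/
noncomputable def discountedState (a : ℝ) {p : ℕ} (s : ℝ × (Fin p → ℝ)) : ℝ :=
  s.1 + ∑ i : Fin p, s.2 i / a ^ ((i : ℕ) + 1)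

lemma discountedState_augDyn {a : ℝ} (ha : a ≠ 0) {p : ℕ} (hp : 1 ≤ p)
    (s : ℝ × (Fin p → ℝ)) (u e : ℝ) :
    discountedState a (augDyn (fun (x u d : ℝ) => a * x + u + d) p s u e) =
      a * discountedState a s + u + e / a ^ p := by
  obtain ⟨n, rfl⟩ : ∃ n, p = n + 1 := ⟨p - 1, by omega⟩
  have htail : ∀ i : Fin n,
      a * (s.2 i.succ / a ^ ((i : ℕ) + 1 + 1)) = s.2 i.succ / a ^ ((i : ℕ) + 1) := by
    intro i
    rw [pow_succ _ ((i : ℕ) + 1)]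
    field_simp
  have hnext : ∀ i : Fin n, (⟨(i : ℕ) + 1, by omega⟩ : Fin (n + 1)) = i.succ := fun _ => rfl
  have hhead : a * (s.2 0 / a) = s.2 0 := by field_simp
  unfold discountedState augDyn
  rw [Fin.sum_univ_castSucc, Fin.sum_univ_succ (fun i : Fin (n + 1) => s.2 i / _)]
  simp only [Fin.val_castSucc, Fin.val_last, Fin.val_succ, Fin.val_zero, mul_add, Finset.mul_sum,
    htail, zero_add, pow_one, hhead, add_lt_add_iff_right, Fin.is_lt, lt_irrefl, dite_true,
    dite_false, Nat.succ_pos, hnext]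
  simp only [Fin.zero_eta]
  ring

lemma sum_one_div_pow_succ {a : ℝ} (ha : 1 < a) (p : ℕ) :
    ∑ i : Fin p, 1 / a ^ ((i : ℕ) + 1) = (1 - 1 / a ^ p) / (a - 1) := by
  have ha1 : a - 1 ≠ 0 := by linarith
  rw [Fin.sum_univ_eq_sum_range (fun i => 1 / a ^ (i + 1))]
  induction p with
  | zero => simp
  | succ n ih =>
    rw [Finset.sum_range_succ, ih]
    field_simp
    ring

lemma abs_sum_div_pow_le {a D : ℝ} (ha : 1 < a) {p : ℕ} {d : Fin p → ℝ}
    (hd : ∀ i, |d i| ≤ D) :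
    |∑ i : Fin p, d i / a ^ ((i : ℕ) + 1)| ≤ D * ((1 - 1 / a ^ p) / (a - 1)) := by
  rw [← sum_one_div_pow_succ ha, Finset.mul_sum]
  refine (Finset.abs_sum_le_sum_abs _ _).trans (Finset.sum_le_sum fun i _ => ?_)
  rw [abs_div, abs_of_pos (by positivity : 0 < a ^ ((i : ℕ) + 1)), mul_one_div]
  gcongr
  exact hd i

lemma exists_abs_le_abs_add_le {z b c : ℝ} (hb : 0 ≤ b) (hc : 0 ≤ c) (hz : |z| ≤ b + c) :
    ∃ u, |u| ≤ b ∧ |z + u| ≤ c := by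
  rw [abs_le] at hz
  rcases le_total b (-z) with h | h
  · exact ⟨b, abs_le.mpr ⟨by linarith, le_rfl⟩, abs_le.mpr ⟨by linarith, by linarith⟩⟩
  rcases le_total (-z) (-b) with h' | h'
  · exact ⟨-b, abs_le.mpr ⟨le_rfl, by linarith⟩, abs_le.mpr ⟨by linarith, by linarith⟩⟩
  · exact ⟨-z, abs_le.mpr ⟨h', h⟩, by simpa using hc⟩

/-- A symmetric interval of the expected size is the maximal controlled invariant set of a scalar
unstable system. -/
lemma isMaxCIS_scalar {a x₀ v : ℝ} (ha : 1 < a) (hx₀ : v / (a - 1) ≤ x₀) :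
    IsMaxCIS (fun (x u : ℝ) => a * x + u) (Icc (-x₀) x₀ ×ˢ Icc (-v) v)
      (Icc (-(v / (a - 1))) (v / (a - 1))) := by
  have ha1 : 0 < a - 1 := by linarith
  have hM : v / (a - 1) * (a - 1) = v := div_mul_cancel₀ _ ha1.ne'
  set M := v / (a - 1)
  constructor
  · rintro x ⟨h1, h2⟩
    refine ⟨-((a - 1) * x), ⟨⟨by linarith, by linarith⟩, ?_, ?_⟩, ?_⟩
    · simp only
      nlinarith
    · simp only
      nlinarith
    · have : a * x + -((a - 1) * x) = x := by ring
      simpa only [this] using ⟨h1, h2⟩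
  · intro C hC x hx
    have hle := nonpos_of_expanding (C := C) (g := fun x => x - M) (K := x₀ - M) ha
      (fun s hs => by
        obtain ⟨u, ⟨⟨-, h⟩, -⟩, -⟩ := hC s hs
        simpa using h)
      (fun s hs => by
        obtain ⟨u, ⟨-, h, -⟩, hn⟩ := hC s hs
        exact ⟨_, hn, by simp only at h ⊢; linarith⟩) x hx
    have hge := nonpos_of_expanding (C := C) (g := fun x => -x - M) (K := x₀ - M) ha
      (fun s hs => by
        obtain ⟨u, ⟨⟨h, -⟩, -⟩, -⟩ := hC s hs
        simp only at h ⊢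
        linarith)
      (fun s hs => by
        obtain ⟨u, ⟨-, -, h⟩, hn⟩ := hC s hs
        exact ⟨_, hn, by simp only at h ⊢; linarith⟩) x hx
    exact ⟨by linarith, by linarith⟩

lemma hausdorffDist_Icc_neg_self {R M : ℝ} (hR : 0 ≤ R) (hRM : R ≤ M) :
    Metric.hausdorffDist (Icc (-R) R) (Icc (-M) M) = M - R := by
  have hneR : (Icc (-R) R).Nonempty := ⟨0, by simpa using hR⟩
  have hneM : (Icc (-M) M).Nonempty := ⟨0, by simpa using hR.trans hRM⟩
  apply le_antisymm
  · refine Metric.hausdorffDist_le_of_mem_dist (by linarith) ?_ ?_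
    · rintro x ⟨h1, h2⟩
      exact ⟨x, ⟨by linarith, by linarith⟩, by simpa using hRM⟩
    · rintro x ⟨h1, h2⟩
      obtain ⟨u, hu, hxu⟩ := exists_abs_le_abs_add_le (z := x) (b := R) (c := M - R) hR
        (by linarith) (by rw [abs_le]; constructor <;> linarith)
      exact ⟨-u, abs_le.mp (by rwa [abs_neg]), by rwa [Real.dist_eq, sub_neg_eq_add]⟩
  · have hfin := Metric.hausdorffEDist_ne_top_of_nonempty_of_bounded hneM hneR
      (Metric.isBounded_Icc (-M) M) (Metric.isBounded_Icc (-R) R)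
    have hM : M ∈ Icc (-M) M := ⟨by linarith, le_rfl⟩
    rw [Metric.hausdorffDist_comm]
    refine le_trans ?_ (Metric.infDist_le_hausdorffDist_of_mem hM hfin)
    refine (Metric.le_infDist hneR).mpr fun y hy => ?_
    rw [Real.dist_eq]
    exact le_trans (by linarith [hy.2]) (le_abs_self _)

/-- **One-dimensional example.** For `x⁺ = a x + u + d`, `d ∈ [-d̄,d̄]`,
`S_xu = [-x̄,x̄] × [-ū,ū]`, with `a > 1`, `x̄ ≥ (ū+d̄)/(a-1)` and `a^{p-1} ū ≥ d̄`:
the maximal RCIS of the `p`-augmented system is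
`C_{max,p} = {(x,d_{1:p}) | |dᵢ| ≤ d̄, |x + Σᵢ dᵢ/aⁱ| ≤ (ū - d̄/aᵖ)/(a-1)}`; its
projection onto the first coordinate is
`[-(ū+d̄-2d̄/aᵖ)/(a-1), (ū+d̄-2d̄/aᵖ)/(a-1)]`; the maximal CIS of the disturbance
collaborative system `x⁺ = a x + u'`, `u' ∈ [-ū-d̄, ū+d̄]`, in `[-x̄,x̄] × [-ū-d̄,ū+d̄]`
is `[-(ū+d̄)/(a-1), (ū+d̄)/(a-1)]`; and the Hausdorff distance between the projection
and this maximal CIS equals `2d̄/((a-1)aᵖ)`. -/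
theorem one_dim_example (a xb ub db : ℝ) (p : ℕ)
    (ha : 1 < a) (hdb : 0 ≤ db) (hub : 0 < ub)
    (hxb : (ub + db) / (a - 1) ≤ xb)
    (hp : 1 ≤ p) (hpu : db ≤ a ^ (p - 1) * ub) :
    IsMaxRCIS (augDyn (fun (x u d : ℝ) => a * x + u + d) p)
        (Icc (-db) db) (augSafe (Icc (-xb) xb ×ˢ Icc (-ub) ub) (Icc (-db) db) p)
        {s : ℝ × (Fin p → ℝ) | (∀ i, |s.2 i| ≤ db) ∧
          |s.1 + ∑ i : Fin p, s.2 i / a ^ ((i : ℕ) + 1)| ≤ (ub - db / a ^ p) / (a - 1)} ∧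
      Prod.fst '' {s : ℝ × (Fin p → ℝ) | (∀ i, |s.2 i| ≤ db) ∧
          |s.1 + ∑ i : Fin p, s.2 i / a ^ ((i : ℕ) + 1)| ≤ (ub - db / a ^ p) / (a - 1)} =
        Icc (-((ub + db - 2 * db / a ^ p) / (a - 1)))
          ((ub + db - 2 * db / a ^ p) / (a - 1)) ∧
      IsMaxCIS (fun (x u : ℝ) => a * x + u)
        (Icc (-xb) xb ×ˢ Icc (-(ub + db)) (ub + db))
        (Icc (-((ub + db) / (a - 1))) ((ub + db) / (a - 1))) ∧
      Metric.hausdorffDist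
          (Icc (-((ub + db - 2 * db / a ^ p) / (a - 1)))
            ((ub + db - 2 * db / a ^ p) / (a - 1)) : Set ℝ)
          (Icc (-((ub + db) / (a - 1))) ((ub + db) / (a - 1))) =
        2 * db / ((a - 1) * a ^ p) := by
  have ha0 : a ≠ 0 := by linarith
  have ha1 : 0 < a - 1 := by linarith
  have hap : 1 ≤ a ^ p := one_le_pow₀ ha.le
  have hε0 : 0 ≤ db / a ^ p := by positivity
  have hεdb : db / a ^ p ≤ db := div_le_self hdb hap
  have haε : a * (db / a ^ p) ≤ ub := by
    obtain ⟨n, rfl⟩ : ∃ n, p = n + 1 := ⟨p - 1, by omega⟩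
    rw [Nat.add_sub_cancel] at hpu
    have : a * (db / a ^ (n + 1)) = db / a ^ n := by
      rw [pow_succ]
      field_simp
    rw [this, div_le_iff₀ (by positivity)]
    linarith
  have hεub : db / a ^ p ≤ ub := by nlinarith
  have hT : db * ((1 - 1 / a ^ p) / (a - 1)) = (db - db / a ^ p) / (a - 1) := by ring
  have h2 : 2 * db / a ^ p = db / a ^ p + db / a ^ p := by ring
  have hRr : (ub + db - 2 * db / a ^ p) / (a - 1) =
      (ub - db / a ^ p) / (a - 1) + (db - db / a ^ p) / (a - 1) := by
    rw [h2]
    ring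
  have hRM : (ub + db - 2 * db / a ^ p) / (a - 1) ≤ (ub + db) / (a - 1) := by
    rw [h2]
    gcongr
    linarith
  have hdiff : (ub + db) / (a - 1) - (ub + db - 2 * db / a ^ p) / (a - 1) =
      2 * db / ((a - 1) * a ^ p) := by
    field_simp
    ring
  have hT0 : 0 ≤ (db - db / a ^ p) / (a - 1) := div_nonneg (by linarith) ha1.le
  have hr0 : 0 ≤ (ub - db / a ^ p) / (a - 1) := div_nonneg (by linarith) ha1.le
  have hr : (ub - db / a ^ p) / (a - 1) * (a - 1) = ub - db / a ^ p := div_mul_cancel₀ _ ha1.ne'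
  have hrε : db / a ^ p ≤ (ub - db / a ^ p) / (a - 1) := by
    rw [le_div_iff₀ ha1]
    linarith
  refine ⟨⟨?_, ?_⟩, ?_, isMaxCIS_scalar ha hxb, ?_⟩
  · rintro s ⟨hd, hy⟩
    have hsum := abs_sum_div_pow_le ha hd
    rw [hT] at hsum
    change |discountedState a s| ≤ _ at hy
    have hz : |a * discountedState a s| ≤
        ub + ((ub - db / a ^ p) / (a - 1) - db / a ^ p) := by
      rw [abs_mul, abs_of_pos (by linarith : 0 < a)]
      nlinarith
    obtain ⟨u, hu, hzu⟩ := exists_abs_le_abs_add_le hub.le (by linarith) hz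
    refine ⟨u, ⟨⟨abs_le.mp ?_, abs_le.mp hu⟩, fun i => abs_le.mp (hd i)⟩, fun e he => ⟨?_, ?_⟩⟩
    · have hx : s.1 = discountedState a s - ∑ i : Fin p, s.2 i / a ^ ((i : ℕ) + 1) := by
        simp [discountedState]
      have := abs_sub (discountedState a s) (∑ i : Fin p, s.2 i / a ^ ((i : ℕ) + 1))
      rw [← hx] at this
      simp only
      linarith
    · intro i
      simp only [augDyn]
      split_ifs
      · exact hd _
      · exact abs_le.mpr he
    · change |discountedState a _| ≤ _
      rw [discountedState_augDyn ha0 hp]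
      have he' : |e / a ^ p| ≤ db / a ^ p := by
        rw [abs_div, abs_of_pos (by positivity : 0 < a ^ p)]
        gcongr
        exact abs_le.mpr he
      have := abs_add_le (a * discountedState a s + u) (e / a ^ p)
      linarith
  · intro C hC s hs
    have hdC : ∀ s ∈ C, ∀ i, |s.2 i| ≤ db := fun s hs i => by
      obtain ⟨u, ⟨-, h⟩, -⟩ := hC s hs
      exact abs_le.mpr (h i)
    have hyC : ∀ s ∈ C, |discountedState a s| ≤ xb + (db - db / a ^ p) / (a - 1) := by
      intro s hs
      obtain ⟨u, ⟨⟨hx, -⟩, -⟩, -⟩ := hC s hs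
      have hx' : |s.1| ≤ xb := abs_le.mpr hx
      have hsum := abs_sum_div_pow_le ha (hdC s hs)
      rw [hT] at hsum
      exact (abs_add_le _ _).trans (add_le_add hx' hsum)
    have hle := nonpos_of_expanding (C := C)
      (g := fun s => discountedState a s - (ub - db / a ^ p) / (a - 1)) ha
      (fun s hs => sub_le_sub_right ((le_abs_self _).trans (hyC s hs)) _)
      (fun s hs => by
        obtain ⟨u, ⟨⟨-, hu, -⟩, -⟩, hn⟩ := hC s hs
        refine ⟨_, hn db ⟨by linarith, le_rfl⟩, ?_⟩
        simp only at hu ⊢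
        rw [discountedState_augDyn ha0 hp]
        linarith) s hs
    have hge := nonpos_of_expanding (C := C)
      (g := fun s => -discountedState a s - (ub - db / a ^ p) / (a - 1)) ha
      (fun s hs => sub_le_sub_right ((neg_le_abs _).trans (hyC s hs)) _)
      (fun s hs => by
        obtain ⟨u, ⟨⟨-, -, hu⟩, -⟩, hn⟩ := hC s hs
        refine ⟨_, hn (-db) ⟨le_rfl, by linarith⟩, ?_⟩
        simp only at hu ⊢
        rw [discountedState_augDyn ha0 hp, neg_div]
        linarith) s hs
    refine ⟨hdC s hs, ?_⟩
    change |discountedState a s| ≤ _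
    exact abs_le.mpr ⟨by linarith, by linarith⟩
  · rw [hRr]
    ext x
    constructor
    · rintro ⟨s, ⟨hd, hy⟩, rfl⟩
      have hsum := abs_sum_div_pow_le ha hd
      rw [hT] at hsum
      rw [abs_le] at hy hsum
      exact ⟨by linarith, by linarith⟩
    · intro hx
      obtain ⟨w, hw, hxw⟩ := exists_abs_le_abs_add_le (z := x) hT0 hr0
        (abs_le.mpr (by rwa [add_comm ((db - db / a ^ p) / (a - 1))]))
      have hq : 0 < (1 - 1 / a ^ p) / (a - 1) := by
        refine div_pos (sub_pos.mpr ?_) ha1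
        rw [div_lt_one (by positivity)]
        exact one_lt_pow₀ ha (by omega)
      refine ⟨(x, fun _ => w / ((1 - 1 / a ^ p) / (a - 1))), ⟨fun _ => ?_, ?_⟩, rfl⟩
      · rw [abs_div, abs_of_pos hq, div_le_iff₀ hq, hT]
        exact hw
      · simp only [div_eq_mul_one_div (w / _) (a ^ _), ← Finset.mul_sum]
        rwa [sum_one_div_pow_succ ha, div_mul_cancel₀ _ hq.ne']
  · rw [hausdorffDist_Icc_neg_self (by rw [hRr]; exact add_nonneg hr0 hT0) hRM, hdiff]
end
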